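/- arXiv:2008.03815 — 3 statements merged into one kernel-verified Lean document; each statement's English description precedes it below -/
import Mathlib

section
/- Fix a finite set 𝒯 × Σ ⊂ ℕ × ℕ of period pairs, and suppose there exists (τ, σ) ∈ 𝒯 × Σ with σ dividing τ. For each n, choose an n-state 2-neighbor cellular automaton rule f uniformly at random, and let R_{𝒯,Σ,n} be the (random) set of weakly robust periodic solutions of f whose temporal period τ and spatial period σ satisfy (τ, σ) ∈ 𝒯 × Σ. Then there is a constant c(𝒯, Σ) depending only on 𝒯 and Σ such that n · P(R_{𝒯,Σ,n} ≠ ∅) → c(𝒯, Σ) as n → ∞; that is, P(R_{𝒯,Σ,n} ≠ ∅) = c(𝒯, Σ)/n + o(1/n). -/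
open Filter

/-- An `n`-state 2-neighbor cellular automaton rule. -/
abbrev CARule (n : ℕ) := Fin n → Fin n → Fin n

/-- One step of the CA evolution: `ξ_{t+1}(x) = f(ξ_t(x-1), ξ_t(x))`. -/
def caStep {n : ℕ} (f : CARule n) (ξ : ℤ → Fin n) : ℤ → Fin n :=
  fun x => f (ξ (x - 1)) (ξ x)

/-- The trajectory of an initial configuration under the rule `f`. -/
def caTraj {n : ℕ} (f : CARule n) (ξ : ℤ → Fin n) : ℕ → ℤ → Fin n
  | 0 => ξ
  | t + 1 => caStep f (caTraj f ξ t)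

/-- `ξ` is (the initial configuration of) a periodic solution of `f` with
minimal temporal period `τ` and minimal spatial period `σ`. -/
def IsPS {n : ℕ} (f : CARule n) (ξ : ℤ → Fin n) (τ σ : ℕ) : Prop :=
  0 < τ ∧ 0 < σ ∧
  (∀ x : ℤ, ξ (x + (σ : ℤ)) = ξ x) ∧
  (∀ σ' : ℕ, 0 < σ' → (∀ x : ℤ, ξ (x + (σ' : ℤ)) = ξ x) → σ ≤ σ') ∧
  caTraj f ξ τ = ξ ∧
  (∀ τ' : ℕ, 0 < τ' → caTraj f ξ τ' = ξ → τ ≤ τ')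

/-- `η` is a proper initial configuration for the periodic solution `ξ`:
it agrees with `ξ` at all sites `≤ y` for some `y`. -/
def IsProper {n : ℕ} (ξ η : ℤ → Fin n) : Prop :=
  ∃ y : ℤ, ∀ x ≤ y, η x = ξ x

/-- The periodic solution `ξ` of `f` is weakly robust: the expansion velocity is
positive, i.e. there is `v > 0` such that for every proper initial configuration
`η`, eventually (in `t`) the two trajectories agree at all sites `x ≤ v·t`
(equivalently, `inf_η liminf_t s_t(η)/t > 0`). -/
def IsWeaklyRobust {n : ℕ} (f : CARule n) (ξ : ℤ → Fin n) : Prop :=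
  ∃ v : ℝ, 0 < v ∧ ∀ η : ℤ → Fin n, IsProper ξ η →
    ∀ᶠ t : ℕ in atTop, ∀ x : ℤ, (x : ℝ) ≤ v * t → caTraj f η t x = caTraj f ξ t x

/-- The label (τ-periodic sequence) `A` right-extends to `B` under `f`: `A → B`. -/
def RightExtends {n : ℕ} (f : CARule n) (A B : ℕ → Fin n) : Prop :=
  ∀ i : ℕ, f (A i) (B i) = B (i + 1)

/-- The sequence `c_{j+1} = f(a_j, c_j)` started at `c₀`. -/
def chaseSeq {n : ℕ} (f : CARule n) (A : ℕ → Fin n) (c₀ : Fin n) : ℕ → Fin n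
  | 0 => c₀
  | j + 1 => f (A j) (chaseSeq f A c₀ j)

/-- The label `A` decides `B` under `f`: `A ⇒ B`. -/
def Decides {n : ℕ} (f : CARule n) (A B : ℕ → Fin n) : Prop :=
  RightExtends f A B ∧ ∀ c₀ : Fin n, ∃ j : ℕ, chaseSeq f A c₀ j = B j

/-- `T` is a (τ,σ)-periodic array (row index mod τ, column index mod σ). -/
def IsTilePeriodic {n : ℕ} (τ σ : ℕ) (T : ℕ → ℕ → Fin n) : Prop :=
  (∀ i j, T (i + τ) j = T i j) ∧ (∀ i j, T i (j + σ) = T i j)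

/-- The set of states appearing in the tile `T`. -/
def tileStates (n τ σ : ℕ) (T : ℕ → ℕ → Fin n) : Finset (Fin n) :=
  (Finset.range τ ×ˢ Finset.range σ).image fun p => T p.1 p.2

/-- The set of horizontally adjacent pairs appearing in the tile `T`. -/
def tilePairs (n τ σ : ℕ) (T : ℕ → ℕ → Fin n) : Finset (Fin n × Fin n) :=
  (Finset.range τ ×ˢ Finset.range σ).image fun p => (T p.1 p.2, T p.1 (p.2 + 1))

/-- `T` is a tile of a periodic solution: uniqueness of assignment, each row has
minimal period `σ`, and the cyclic sequence of rows has minimal period `τ`. -/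
def IsPSTile (n τ σ : ℕ) (T : ℕ → ℕ → Fin n) : Prop :=
  IsTilePeriodic τ σ T ∧
  (∀ i j k m, T i j = T k m → T i (j + 1) = T k (m + 1) →
      T (i + 1) (j + 1) = T (k + 1) (m + 1)) ∧
  (∀ i : ℕ, ∀ σ' : ℕ, 0 < σ' → (∀ j, T i (j + σ') = T i j) → σ ≤ σ') ∧
  (∀ τ' : ℕ, 0 < τ' → (∀ i j, T (i + τ') j = T i j) → τ ≤ τ')

/-- `T` is a tile of a periodic solution of the given rule `f`. -/
def IsPSTileOf {n : ℕ} (f : CARule n) (τ σ : ℕ) (T : ℕ → ℕ → Fin n) : Prop :=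
  IsTilePeriodic τ σ T ∧
  (∀ i j, f (T i j) (T i (j + 1)) = T (i + 1) (j + 1)) ∧
  (∀ i : ℕ, ∀ σ' : ℕ, 0 < σ' → (∀ j, T i (j + σ') = T i j) → σ ≤ σ') ∧
  (∀ τ' : ℕ, 0 < τ' → (∀ i j, T (i + τ') j = T i j) → τ ≤ τ')

/-- `T` is simple: the assignment number `p(T)` equals the number of states `s(T)`. -/
def IsSimpleTile (n τ σ : ℕ) (T : ℕ → ℕ → Fin n) : Prop :=
  (tilePairs n τ σ T).card = (tileStates n τ σ T).card

/-- The rank of a tile: the largest `x` such that some `x` columns of `T`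
together contain `x * τ` pairwise distinct states. -/
noncomputable def tileRank (n τ σ : ℕ) (T : ℕ → ℕ → Fin n) : ℕ :=
  sSup {x : ℕ | ∃ J : Finset ℕ, J ⊆ Finset.range σ ∧ J.card = x ∧
    ((J ×ˢ Finset.range τ).image fun p => T p.2 p.1).card = x * τ}

/-- The tile of the periodic solution `ξ` of `f`: `a_{i,j} = ξ_i(j)`. -/
def psTile {n : ℕ} (f : CARule n) (ξ : ℤ → Fin n) : ℕ → ℕ → Fin n :=
  fun i j => caTraj f ξ i (j : ℤ)

namespace WRPS

/-- `T` is a doubly `M`-periodic space-time array of the rule `f`. -/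
def IsTile {n M : ℕ} (f : CARule n) (T : ZMod M × ZMod M → Fin n) : Prop :=
  ∀ g, f (T g) (T (g + (0, 1))) = T (g + (1, 1))

/-- Every column of the array `T` decides the next one, from every phase. -/
def ColumnsDecide {n M : ℕ} (f : CARule n) (T : ZMod M × ZMod M → Fin n) : Prop :=
  ∀ g c, ∃ j : ℕ, chaseSeq f (fun i => T (g + ((i : ZMod M), 0))) c j = T (g + ((j : ZMod M), 1))

/-- The minimal temporal and spatial periods of the array `T` lie in `𝒯` and `𝒮`. -/
def HasPeriodsIn {n M : ℕ} (𝒯 𝒮 : Finset ℕ) (T : ZMod M × ZMod M → Fin n) : Prop :=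
  ∃ τ ∈ 𝒯, ∃ σ ∈ 𝒮, 0 < τ ∧ 0 < σ ∧
    (∀ g, T (g + ((τ : ZMod M), 0)) = T g) ∧
    (∀ τ' : ℕ, 0 < τ' → (∀ g, T (g + ((τ' : ZMod M), 0)) = T g) → τ ≤ τ') ∧
    (∀ g, T (g + (0, (σ : ZMod M))) = T g) ∧
    (∀ σ' : ℕ, 0 < σ' → (∀ g, T (g + (0, (σ' : ZMod M))) = T g) → σ ≤ σ')

/-- The array `T` records the trajectory of `ξ`. -/
def Records {n M : ℕ} (f : CARule n) (ξ : ℤ → Fin n) (T : ZMod M × ZMod M → Fin n) : Prop :=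
  ∀ (i : ℕ) (x : ℤ), caTraj f ξ i x = T (i, x)

lemma exists_lift {M : ℕ} [NeZero M] (g : ZMod M × ZMod M) :
    ∃ (i : ℕ) (x : ℤ), g = ((i : ZMod M), (x : ZMod M)) := by
  obtain ⟨i, hi⟩ := ZMod.natCast_zmod_surjective g.1
  obtain ⟨x, hx⟩ := ZMod.intCast_surjective g.2
  exact ⟨i, x, by rw [hi, hx]⟩

lemma caTraj_add {n : ℕ} (f : CARule n) (ξ : ℤ → Fin n) (s t : ℕ) :
    caTraj f ξ (s + t) = caTraj f (caTraj f ξ s) t := by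
  induction t with
  | zero => rfl
  | succ t ih => rw [← add_assoc]; simp only [caTraj, ih]

lemma caTraj_shift {n : ℕ} (f : CARule n) {ξ : ℤ → Fin n} {σ : ℤ} (h : ∀ x, ξ (x + σ) = ξ x)
    (t : ℕ) (x : ℤ) : caTraj f ξ t (x + σ) = caTraj f ξ t x := by
  induction t generalizing x with
  | zero => exact h x
  | succ t ih => simp only [caTraj, caStep, ← ih x, ← ih (x - 1), sub_add_eq_add_sub]

lemma caTraj_mul_period {n : ℕ} (f : CARule n) {ξ : ℤ → Fin n} {τ : ℕ} (h : caTraj f ξ τ = ξ)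
    (k : ℕ) : caTraj f ξ (τ * k) = ξ := by
  induction k with
  | zero => rfl
  | succ k ih => rw [mul_add, mul_one, caTraj_add, ih, h]

lemma shift_mul {n : ℕ} {ξ : ℤ → Fin n} {σ : ℤ} (h : ∀ x, ξ (x + σ) = ξ x) (k : ℤ) (x : ℤ) :
    ξ (x + σ * k) = ξ x := by
  have := (show Function.Periodic ξ σ from h).int_mul k x
  simpa [mul_comm] using this

lemma exists_records {n M : ℕ} [NeZero M] {f : CARule n} {ξ : ℤ → Fin n} {τ σ : ℕ}
    (h : IsPS f ξ τ σ) (hτ : τ ∣ M) (hσ : σ ∣ M) :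
    ∃ T : ZMod M × ZMod M → Fin n, Records f ξ T := by
  obtain ⟨-, -, hs, -, ht, -⟩ := h
  obtain ⟨a, ha⟩ := hτ
  obtain ⟨b, hb⟩ := hσ
  have hM : caTraj f ξ M = ξ := by rw [ha]; exact caTraj_mul_period f ht a
  have hM' : ∀ x, ξ (x + (M : ℤ)) = ξ x := fun x => by
    have := shift_mul hs b x
    rw [hb]; push_cast; exact this
  refine ⟨fun g => caTraj f ξ g.1.val (g.2.val : ℤ), fun i x => ?_⟩
  have h1 : caTraj f ξ i = caTraj f ξ ((i : ZMod M).val) := by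
    rw [ZMod.val_natCast]
    conv_lhs => rw [← Nat.div_add_mod i M, caTraj_add, caTraj_mul_period f hM]
  have h2 : ((x : ZMod M).val : ℤ) = x % M := ZMod.val_intCast x
  simp only [h2, h1]
  conv_lhs => rw [← Int.emod_add_mul_ediv x M]
  exact shift_mul (caTraj_shift f hM' _) _ _

lemma IsTile.records {n M : ℕ} {f : CARule n} {T : ZMod M × ZMod M → Fin n}
    (h : IsTile f T) : Records f (fun x => T (0, x)) T := by
  intro i
  induction i with
  | zero => intro x; simp [caTraj]
  | succ i ih =>
    intro x
    have := h ((i : ZMod M), ((x - 1 : ℤ) : ZMod M))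
    simpa [caTraj, caStep, ih] using this

lemma Records.isTile {n M : ℕ} [NeZero M] {f : CARule n} {ξ : ℤ → Fin n}
    {T : ZMod M × ZMod M → Fin n} (h : Records f ξ T) : IsTile f T := by
  intro g
  obtain ⟨i, x, rfl⟩ := exists_lift g
  have h1 := h (i + 1) (x + 1)
  simp only [caTraj, caStep, add_sub_cancel_right] at h1
  rw [h i x, h i (x + 1)] at h1
  simpa using h1

lemma IsTile.chaseSeq_eq_of_le {n M : ℕ} {f : CARule n} {T : ZMod M × ZMod M → Fin n}
    (h : IsTile f T) {g : ZMod M × ZMod M} {c : Fin n} {j k : ℕ} (hjk : j ≤ k)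
    (hj : chaseSeq f (fun i => T (g + ((i : ZMod M), 0))) c j = T (g + ((j : ZMod M), 1))) :
    chaseSeq f (fun i => T (g + ((i : ZMod M), 0))) c k = T (g + ((k : ZMod M), 1)) := by
  induction k, hjk using Nat.le_induction with
  | base => exact hj
  | succ k _ ih =>
    have := h (g + ((k : ZMod M), 0))
    simp only [add_assoc, Prod.mk_add_mk, add_zero, zero_add] at this
    simp [chaseSeq, ih, this]

lemma chaseSeq_add {n : ℕ} (f : CARule n) (A : ℕ → Fin n) (c : Fin n) (s t : ℕ) :
    chaseSeq f A c (s + t) = chaseSeq f (fun i => A (s + i)) (chaseSeq f A c s) t := by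
  induction t with
  | zero => rfl
  | succ t ih => rw [← add_assoc]; simp [chaseSeq, ih]

/-- It suffices to check decision at phase zero. -/
lemma columnsDecide_of_phase_zero {n M : ℕ} [NeZero M] {f : CARule n}
    {T : ZMod M × ZMod M → Fin n}
    (h : ∀ (x : ℤ) (c : Fin n), ∃ j : ℕ,
      chaseSeq f (fun i => T ((i : ZMod M), (x : ZMod M))) c j
        = T ((j : ZMod M), ((x + 1 : ℤ) : ZMod M))) :
    ColumnsDecide f T := by
  intro g c
  obtain ⟨i, x, rfl⟩ := exists_lift g
  obtain ⟨s, hs⟩ : ∃ s : ℕ, ((i : ZMod M) + (s : ZMod M)) = 0 := by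
    obtain ⟨s, hs⟩ := ZMod.natCast_zmod_surjective (-(i : ZMod M))
    exact ⟨s, by rw [hs]; ring⟩
  obtain ⟨j, hj⟩ := h x
    (chaseSeq f (fun k => T (((i : ZMod M), (x : ZMod M)) + ((k : ZMod M), 0))) c s)
  refine ⟨s + j, ?_⟩
  rw [chaseSeq_add]
  convert hj using 3
  · simp [← add_assoc, hs]
  · simp [← add_assoc, hs]
  · simp

/-- The trajectory to the right of a region of agreement follows the chase of the last column. -/
lemma caTraj_eq_chaseSeq {n M : ℕ} {f : CARule n} {ξ η : ℤ → Fin n}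
    {T : ZMod M × ZMod M → Fin n} (h : Records f ξ T) {s : ℕ} {y : ℤ}
    (hag : ∀ t, s ≤ t → caTraj f η t y = caTraj f ξ t y) (t : ℕ) :
    caTraj f η (s + t) (y + 1) = chaseSeq f
      (fun i => T (((s : ZMod M), (y : ZMod M)) + ((i : ZMod M), 0))) (caTraj f η s (y + 1)) t := by
  induction t with
  | zero => rfl
  | succ t ih =>
    have := hag (s + t) (by omega)
    rw [h] at this
    rw [← add_assoc]
    simp only [caTraj, caStep, chaseSeq, ih, add_sub_cancel_right, this]
    simp

lemma caTraj_agree {n : ℕ} {f : CARule n} {ξ η : ℤ → Fin n} {s : ℕ} {y : ℤ}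
    (h : ∀ x ≤ y, caTraj f η s x = caTraj f ξ s x) {t : ℕ} (ht : s ≤ t) :
    ∀ x ≤ y, caTraj f η t x = caTraj f ξ t x := by
  induction t, ht using Nat.le_induction with
  | base => exact h
  | succ t _ ih =>
    intro x hx
    simp only [caTraj, caStep, ih x hx, ih (x - 1) (by omega)]

lemma Records.columnsDecide {n M : ℕ} [NeZero M] {f : CARule n} {ξ : ℤ → Fin n}
    {T : ZMod M × ZMod M → Fin n} (h : Records f ξ T) (hw : IsWeaklyRobust f ξ) :
    ColumnsDecide f T := by
  refine columnsDecide_of_phase_zero fun x c => ?_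
  obtain ⟨v, hv, hw⟩ := hw
  set η : ℤ → Fin n := fun z => if z ≤ x then ξ z else c with hη
  have hp : ∀ z ≤ x, η z = ξ z := fun z hz => by simp [hη, hz]
  have hlim : Tendsto (fun t : ℕ => v * (t : ℝ)) atTop atTop :=
    tendsto_natCast_atTop_atTop.const_mul_atTop hv
  obtain ⟨t, ht, ht'⟩ :=
    ((hw η ⟨x, hp⟩).and (hlim.eventually_ge_atTop (((x + 1 : ℤ) : ℝ)))).exists
  refine ⟨t, ?_⟩
  have h1 := ht (x + 1) ht'
  have h2 := caTraj_eq_chaseSeq h (s := 0) (y := x) (η := η)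
    (fun t ht => caTraj_agree (s := 0) (y := x) hp ht x le_rfl) t
  rw [zero_add, h1, h] at h2
  rw [h2]
  simp [caTraj, hη]

lemma Records.isWeaklyRobust {n M : ℕ} [NeZero M] {f : CARule n} {ξ : ℤ → Fin n}
    {T : ZMod M × ZMod M → Fin n} (h : Records f ξ T) (hd : ColumnsDecide f T) :
    IsWeaklyRobust f ξ := by
  choose j hj using hd
  obtain ⟨N, hN⟩ : ∃ N : ℕ, ∀ g c, j g c ≤ N :=
    ⟨∑ p : (ZMod M × ZMod M) × Fin n, j p.1 p.2, fun g c =>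
      Finset.single_le_sum (f := fun p : (ZMod M × ZMod M) × Fin n => j p.1 p.2)
        (fun _ _ => Nat.zero_le _) (Finset.mem_univ (g, c))⟩
  have hNpos : (0 : ℝ) < N + 1 := by positivity
  refine ⟨1 / (2 * (N + 1)), by positivity, fun η ⟨y, hy⟩ => ?_⟩
  have key : ∀ k : ℕ, ∀ x ≤ y + k, caTraj f η (k * (N + 1)) x = caTraj f ξ (k * (N + 1)) x := by
    intro k
    induction k with
    | zero => intro x hx; simpa [caTraj] using hy x (by simpa using hx)
    | succ k ih =>
      have hstay := fun t ht => caTraj_agree ih (t := t) ht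
      intro x hx
      rw [add_mul, one_mul]
      rcases (show x ≤ y + k ∨ x = y + k + 1 by push_cast at hx; omega) with hx | rfl
      · exact hstay _ (by omega) x hx
      · rw [caTraj_eq_chaseSeq h (fun t ht => hstay t ht _ le_rfl),
          h.isTile.chaseSeq_eq_of_le ((hN _ _).trans (Nat.le_succ N)) (hj _ _), h]
        simp
  filter_upwards [tendsto_natCast_atTop_atTop.eventually_ge_atTop
    (2 * (N + 1 : ℝ) * (1 - y))] with t ht x hx
  refine caTraj_agree (key (t / (N + 1))) (Nat.div_mul_le_self _ _) x ?_
  have h1 : (t : ℝ) ≤ (N + 1) * ((t / (N + 1) : ℕ) + 1 : ℝ) := by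
    have := (Nat.lt_mul_div_succ t (Nat.succ_pos N)).le
    exact_mod_cast this
  have h2 : (x : ℝ) ≤ y + (t / (N + 1) : ℕ) := by
    refine hx.trans ?_
    rw [div_mul_eq_mul_div, one_mul, div_le_iff₀ (by positivity)]
    nlinarith
  rw [← Int.cast_natCast (t / (N + 1)), ← Int.cast_add] at h2
  exact Int.cast_le.1 h2

lemma Records.isPS_iff {n M : ℕ} [NeZero M] {f : CARule n} {ξ : ℤ → Fin n}
    {T : ZMod M × ZMod M → Fin n} (h : Records f ξ T) (τ σ : ℕ) :
    IsPS f ξ τ σ ↔ 0 < τ ∧ 0 < σ ∧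
    (∀ g, T (g + ((τ : ZMod M), 0)) = T g) ∧
    (∀ τ' : ℕ, 0 < τ' → (∀ g, T (g + ((τ' : ZMod M), 0)) = T g) → τ ≤ τ') ∧
    (∀ g, T (g + (0, (σ : ZMod M))) = T g) ∧
    (∀ σ' : ℕ, 0 < σ' → (∀ g, T (g + (0, (σ' : ZMod M))) = T g) → σ ≤ σ') := by
  have ht : ∀ τ : ℕ, caTraj f ξ τ = ξ ↔ ∀ g, T (g + ((τ : ZMod M), 0)) = T g := by
    intro τ
    constructor
    · intro hτ g
      obtain ⟨i, x, rfl⟩ := exists_lift g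
      have := h (τ + i) x
      rw [caTraj_add, hτ, h] at this
      simpa [add_comm] using this.symm
    · intro hT
      ext1 x
      have h0 := h 0 x
      have := hT (0, x)
      simp only [caTraj] at h0
      rw [h, h0]
      simpa using this
  have hs : ∀ σ : ℕ, (∀ x : ℤ, ξ (x + (σ : ℤ)) = ξ x) ↔
      ∀ g, T (g + (0, (σ : ZMod M))) = T g := by
    intro σ
    constructor
    · intro hσ g
      obtain ⟨i, x, rfl⟩ := exists_lift g
      have := caTraj_shift f hσ i x
      rw [h, h] at this
      simpa using this
    · intro hT x
      have h0 := h 0 x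
      have h1 := h 0 (x + σ)
      have := hT (0, x)
      simp only [caTraj] at h0 h1
      rw [h1, h0]
      simpa using this
  simp only [IsPS, ht, hs]
  tauto

/-- Weakly robust periodic solutions correspond to periodic arrays with deciding columns. -/
lemma exists_wrps_iff {n M : ℕ} [NeZero M] {𝒯 𝒮 : Finset ℕ}
    (h𝒯 : ∀ τ ∈ 𝒯, 0 < τ → τ ∣ M) (h𝒮 : ∀ σ ∈ 𝒮, 0 < σ → σ ∣ M) (f : CARule n) :
    (∃ (ξ : ℤ → Fin n) (τ σ : ℕ), τ ∈ 𝒯 ∧ σ ∈ 𝒮 ∧ IsPS f ξ τ σ ∧ IsWeaklyRobust f ξ) ↔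
      ∃ T : ZMod M × ZMod M → Fin n, HasPeriodsIn 𝒯 𝒮 T ∧ IsTile f T ∧ ColumnsDecide f T := by
  constructor
  · rintro ⟨ξ, τ, σ, hτ, hσ, hps, hw⟩
    obtain ⟨T, hT⟩ := exists_records (M := M) hps (h𝒯 τ hτ hps.1) (h𝒮 σ hσ hps.2.1)
    exact ⟨T, ⟨τ, hτ, σ, hσ, (hT.isPS_iff τ σ).1 hps⟩, hT.isTile, hT.columnsDecide hw⟩
  · rintro ⟨T, ⟨τ, hτ, σ, hσ, hper⟩, hT, hd⟩
    exact ⟨_, τ, σ, hτ, hσ, (hT.records.isPS_iff τ σ).2 hper, hT.records.isWeaklyRobust hd⟩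

end WRPS

namespace WRPS

/-- The rule `f` with its value at the pair `p` replaced by `y`. -/
def overwrite {n : ℕ} (f : CARule n) (p : Fin n × Fin n) (y : Fin n) : CARule n :=
  Function.update f p.1 (Function.update (f p.1) p.2 y)

lemma overwrite_self {n : ℕ} (f : CARule n) (p : Fin n × Fin n) (y : Fin n) :
    overwrite f p y p.1 p.2 = y := by
  simp [overwrite]

lemma overwrite_of_ne {n : ℕ} (f : CARule n) {p : Fin n × Fin n} (y : Fin n) {a b : Fin n}
    (h : (a, b) ≠ p) : overwrite f p y a b = f a b := by
  unfold overwrite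
  by_cases ha : a = p.1
  · subst ha
    have hb : b ≠ p.2 := fun hb => h (by rw [hb])
    simp [hb]
  · simp [ha]

lemma overwrite_overwrite {n : ℕ} (f : CARule n) (p : Fin n × Fin n) (y : Fin n) :
    overwrite (overwrite f p y) p (f p.1 p.2) = f := by
  simp [overwrite]

lemma chaseSeq_overwrite {n : ℕ} {f : CARule n} {A : ℕ → Fin n} {c : Fin n} {p : Fin n × Fin n}
    (y : Fin n) {t : ℕ} (h : ∀ u < t, (A u, chaseSeq f A c u) ≠ p) :
    ∀ u ≤ t, chaseSeq (overwrite f p y) A c u = chaseSeq f A c u := by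
  intro u
  induction u with
  | zero => intro _; rfl
  | succ u ih =>
    intro hu
    simp only [chaseSeq, ih (by omega)]
    exact overwrite_of_ne f y (h u (by omega))

/-- The chase of `A` from `c` enters `S` for the first time at time `t + 1`. -/
def EntersAt {n : ℕ} (f : CARule n) (A : ℕ → Fin n) (c : Fin n) (S : Finset (Fin n)) (t : ℕ) :
    Prop :=
  chaseSeq f A c (t + 1) ∈ S ∧ ∀ u ≤ t, chaseSeq f A c u ∉ S

section Entrance

variable {n : ℕ} {f : CARule n} {A : ℕ → Fin n} {c : Fin n} {S : Finset (Fin n)} {t : ℕ}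

lemma exists_entersAt (hc : c ∉ S) (h : ∃ j, chaseSeq f A c j ∈ S) : ∃ t, EntersAt f A c S t := by
  classical
  obtain ⟨t, ht⟩ : ∃ t, Nat.find h = t + 1 := by
    refine Nat.exists_eq_succ_of_ne_zero fun h0 => hc ?_
    have := Nat.find_spec h
    rw [h0] at this
    exact this
  refine ⟨t, ?_, fun u hu => Nat.find_min h (by omega)⟩
  rw [← ht]
  exact Nat.find_spec h

lemma EntersAt.chaseSeq_overwrite (h : EntersAt f A c S t) (y : Fin n) :
    ∀ u ≤ t, chaseSeq (overwrite f (A t, chaseSeq f A c t) y) A c u = chaseSeq f A c u := by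
  refine WRPS.chaseSeq_overwrite y fun u hu he => h.2 (u + 1) hu ?_
  have h1 := h.1
  rw [Prod.ext_iff] at he
  dsimp only at he
  simp only [chaseSeq, he.1, he.2] at h1 ⊢
  exact h1

lemma EntersAt.chaseSeq_overwrite_succ (h : EntersAt f A c S t) (y : Fin n) :
    chaseSeq (overwrite f (A t, chaseSeq f A c t) y) A c (t + 1) = y := by
  simp only [chaseSeq, h.chaseSeq_overwrite y t le_rfl]
  exact overwrite_self f (A t, chaseSeq f A c t) y

lemma EntersAt.ne_of_lt (h : EntersAt f A c S t) {M : ℕ} (hA : ∀ i, A (i + M) = A i)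
    {u w : ℕ} (huw : u < w) (hw : w ≤ t) (hmod : u ≡ w [MOD M]) :
    chaseSeq f A c u ≠ chaseSeq f A c w := by
  intro he
  have hAm : ∀ i, A (u + i) = A (w + i) := fun i => by
    rw [← Function.Periodic.map_mod_nat hA (u + i), ← Function.Periodic.map_mod_nat hA (w + i),
      hmod.add_right i]
  have key : ∀ i, chaseSeq f A c (u + i) = chaseSeq f A c (w + i) := by
    intro i
    induction i with
    | zero => exact he
    | succ i ih =>
      change f (A (u + i)) (chaseSeq f A c (u + i)) = f (A (w + i)) (chaseSeq f A c (w + i))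
      rw [ih, hAm]
  refine h.2 (u + (t + 1 - w)) (by omega) ?_
  rw [key, Nat.add_sub_cancel' (by omega)]
  exact h.1

/-- Overwriting at the entrance determines the original rule. -/
lemma eq_of_overwrite_eq {f₁ f₂ : CARule n} (h₁ : EntersAt f₁ A c S t) (h₂ : EntersAt f₂ A c S t)
    {y₁ y₂ : Fin n} (he : overwrite f₁ (A t, chaseSeq f₁ A c t) y₁ =
      overwrite f₂ (A t, chaseSeq f₂ A c t) y₂)
    (hv : chaseSeq f₁ A c (t + 1) = chaseSeq f₂ A c (t + 1)) : f₁ = f₂ ∧ y₁ = y₂ := by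
  have hc : chaseSeq f₁ A c t = chaseSeq f₂ A c t := by
    rw [← h₁.chaseSeq_overwrite y₁ t le_rfl, he, h₂.chaseSeq_overwrite y₂ t le_rfl]
  constructor
  · rw [← overwrite_overwrite f₁ (A t, chaseSeq f₁ A c t) y₁, he,
      ← overwrite_overwrite f₂ (A t, chaseSeq f₂ A c t) y₂, hc]
    have hv' : f₁ (A t) (chaseSeq f₂ A c t) = f₂ (A t) (chaseSeq f₂ A c t) := by
      have hv'' := hv
      simp only [chaseSeq, hc] at hv''
      exact hv''
    simp only [hv', overwrite_overwrite]
  · rw [← h₁.chaseSeq_overwrite_succ y₁, he, h₂.chaseSeq_overwrite_succ y₂]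

end Entrance

open Classical in
/-- The rules with prescribed values on the pairs in `Q`. -/
noncomputable def prescribed {n : ℕ} (Q : Finset (Fin n × Fin n)) (F : CARule n) :
    Finset (CARule n) :=
  Finset.univ.filter fun f => ∀ p ∈ Q, f p.1 p.2 = F p.1 p.2

lemma mem_prescribed {n : ℕ} {Q : Finset (Fin n × Fin n)} {F f : CARule n} :
    f ∈ prescribed Q F ↔ ∀ p ∈ Q, f p.1 p.2 = F p.1 p.2 := by
  simp [prescribed]

lemma overwrite_mem_prescribed {n : ℕ} {Q : Finset (Fin n × Fin n)} {F f : CARule n}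
    (hf : f ∈ prescribed Q F) {p : Fin n × Fin n} (hp : p ∉ Q) (y : Fin n) :
    overwrite f p y ∈ prescribed Q F := by
  rw [mem_prescribed] at hf ⊢
  intro q hq
  rw [overwrite_of_ne f y (fun h : q = p => hp (h ▸ hq))]
  exact hf q hq

section Counting

variable {n : ℕ} {S : Finset (Fin n)} {Q : Finset (Fin n × Fin n)} (hQ : ∀ p ∈ Q, p.2 ∈ S)
  (F : CARule n) (A : ℕ → Fin n) (c : Fin n)
include hQ

open Classical in
lemma card_entersAt_mul_le (t : ℕ) :
    ((prescribed Q F).filter fun f => EntersAt f A c S t).card * n ≤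
      (prescribed Q F).card * S.card := by
  calc _ = (((prescribed Q F).filter fun f => EntersAt f A c S t) ×ˢ
        (Finset.univ : Finset (Fin n))).card := by simp
    _ ≤ ((prescribed Q F) ×ˢ S).card := ?_
    _ = _ := Finset.card_product _ _
  refine Finset.card_le_card_of_injOn
    (fun q => (overwrite q.1 (A t, chaseSeq q.1 A c t) q.2, chaseSeq q.1 A c (t + 1))) ?_ ?_
  · rintro ⟨f, y⟩ hq
    simp only [Finset.coe_product, Set.mem_prod, Finset.mem_coe, Finset.mem_filter] at hq ⊢
    obtain ⟨⟨hf, he⟩, -⟩ := hq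
    exact ⟨overwrite_mem_prescribed hf (fun h => he.2 t le_rfl (hQ _ h)) y, he.1⟩
  · rintro ⟨f₁, y₁⟩ h₁ ⟨f₂, y₂⟩ h₂ h
    simp only [Finset.coe_product, Set.mem_prod, Finset.mem_coe, Finset.mem_filter] at h₁ h₂
    rw [Prod.ext_iff] at h
    obtain ⟨rfl, rfl⟩ := eq_of_overwrite_eq h₁.1.2 h₂.1.2 h.1 h.2
    rfl

open Classical in
lemma card_late_mul_le {M : ℕ} (hM : 0 < M) (hA : ∀ i, A (i + M) = A i) (K : ℕ) :
    ((prescribed Q F).filter fun f => ∃ t, K * M ≤ t ∧ EntersAt f A c S t).card * K ≤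
      (prescribed Q F).card * S.card := by
  have hex : ∀ f : CARule n, ∃ t, (∃ t, K * M ≤ t ∧ EntersAt f A c S t) →
      K * M ≤ t ∧ EntersAt f A c S t := fun f => by
    by_cases h : ∃ t, K * M ≤ t ∧ EntersAt f A c S t
    · exact ⟨h.choose, fun _ => h.choose_spec⟩
    · exact ⟨0, fun h' => absurd h' h⟩
  choose t ht using hex
  have hK : ∀ k : ℕ, k < K → (k + 1) * M ≤ K * M := fun k hk => Nat.mul_le_mul_right M hk
  rw [← Finset.card_range K, ← Finset.card_product, ← Finset.card_product, Finset.card_range]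
  refine Finset.card_le_card_of_injOn (fun q => (overwrite q.1 (A (t q.1), chaseSeq q.1 A c (t q.1))
    (chaseSeq q.1 A c (t q.1 + 1 - (q.2 + 1) * M)), chaseSeq q.1 A c (t q.1 + 1))) ?_ ?_
  · rintro ⟨f, k⟩ hq
    simp only [Finset.coe_product, Set.mem_prod, Finset.mem_coe, Finset.mem_filter] at hq ⊢
    obtain ⟨⟨hf, he⟩, -⟩ := hq
    have he := (ht f he).2
    exact ⟨overwrite_mem_prescribed hf (fun h => he.2 _ le_rfl (hQ _ h)) _, he.1⟩
  · rintro ⟨f₁, k₁⟩ h₁ ⟨f₂, k₂⟩ h₂ h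
    simp only [Finset.coe_product, Set.mem_prod, Finset.mem_coe, Finset.mem_filter,
      Finset.mem_range] at h₁ h₂
    simp only [Prod.mk.injEq] at h
    obtain ⟨⟨-, he₁⟩, hk₁⟩ := h₁
    obtain ⟨⟨-, he₂⟩, hk₂⟩ := h₂
    obtain ⟨hl₁, he₁⟩ := ht f₁ he₁
    obtain ⟨hl₂, he₂⟩ := ht f₂ he₂
    obtain ⟨heq, hv⟩ := h
    have H₁ := hK k₁ hk₁
    have H₂ := hK k₂ hk₂
    have hp₁ : M ≤ (k₁ + 1) * M := Nat.le_mul_of_pos_left M (Nat.succ_pos _)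
    have hp₂ : M ≤ (k₂ + 1) * M := Nat.le_mul_of_pos_left M (Nat.succ_pos _)
    have hm : ∀ t k : ℕ, (k + 1) * M ≤ t + 1 → t + 1 - (k + 1) * M ≡ t + 1 [MOD M] := by
      intro t k h
      have := (Nat.modEq_iff_dvd' (n := M) (Nat.sub_le (t + 1) ((k + 1) * M))).2
        (by rw [Nat.sub_sub_self h]; exact Dvd.intro_left _ rfl)
      exact this
    have htt : t f₁ = t f₂ := by
      rcases lt_trichotomy (t f₁) (t f₂) with hlt | h | hlt
      · exfalso
        refine he₂.ne_of_lt hA (u := t f₁ + 1 - (k₁ + 1) * M) (w := t f₁ + 1) (by omega)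
          (by omega) (hm _ _ (by omega)) ?_
        rw [← he₂.chaseSeq_overwrite (chaseSeq f₂ A c (t f₂ + 1 - (k₂ + 1) * M)) _ (by omega),
          ← he₂.chaseSeq_overwrite (chaseSeq f₂ A c (t f₂ + 1 - (k₂ + 1) * M)) (t f₁ + 1)
          (by omega), ← heq, he₁.chaseSeq_overwrite_succ, he₁.chaseSeq_overwrite _ _ (by omega)]
      · exact h
      · exfalso
        refine he₁.ne_of_lt hA (u := t f₂ + 1 - (k₂ + 1) * M) (w := t f₂ + 1) (by omega)
          (by omega) (hm _ _ (by omega)) ?_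
        rw [← he₁.chaseSeq_overwrite (chaseSeq f₁ A c (t f₁ + 1 - (k₁ + 1) * M)) _ (by omega),
          ← he₁.chaseSeq_overwrite (chaseSeq f₁ A c (t f₁ + 1 - (k₁ + 1) * M)) (t f₂ + 1)
          (by omega), heq, he₂.chaseSeq_overwrite_succ, he₂.chaseSeq_overwrite _ _ (by omega)]
    rw [← htt] at heq hv he₂
    obtain ⟨rfl, hy⟩ := eq_of_overwrite_eq he₁ he₂ heq hv
    refine Prod.ext rfl ?_
    by_contra hne
    have hmm := (hm (t f₁) k₁ (by omega)).trans (hm (t f₁) k₂ (by omega)).symm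
    have hnm : (k₁ + 1) * M ≠ (k₂ + 1) * M := fun h =>
      hne (by simpa using Nat.eq_of_mul_eq_mul_right hM h)
    rcases lt_or_gt_of_ne hnm with hlt | hlt
    · exact he₁.ne_of_lt hA (by omega) (by omega) hmm.symm hy.symm
    · exact he₁.ne_of_lt hA (by omega) (by omega) hmm hy

open Classical in
/-- A chase started outside `S` is unlikely to ever enter `S`. -/
lemma card_enters_mul_le (hc : c ∉ S) {M : ℕ} (hM : 0 < M) (hA : ∀ i, A (i + M) = A i) (K : ℕ) :
    ((prescribed Q F).filter fun f => ∃ j, chaseSeq f A c j ∈ S).card * (K * n) ≤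
      (prescribed Q F).card * S.card * (K * (K * M) + n) := by
  have hsub : ((prescribed Q F).filter fun f => ∃ j, chaseSeq f A c j ∈ S) ⊆
      ((Finset.range (K * M)).biUnion fun t =>
        (prescribed Q F).filter fun f => EntersAt f A c S t) ∪
      (prescribed Q F).filter fun f => ∃ t, K * M ≤ t ∧ EntersAt f A c S t := by
    intro f hf
    rw [Finset.mem_filter] at hf
    obtain ⟨t, ht⟩ := exists_entersAt hc hf.2
    rw [Finset.mem_union]
    rcases lt_or_ge t (K * M) with h | h
    · exact Or.inl (Finset.mem_biUnion.2 ⟨t, Finset.mem_range.2 h, Finset.mem_filter.2 ⟨hf.1, ht⟩⟩)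
    · exact Or.inr (Finset.mem_filter.2 ⟨hf.1, t, h, ht⟩)
  have h1 := (Finset.card_le_card hsub).trans (Finset.card_union_le _ _)
  have h2 := (Finset.card_biUnion_le (s := Finset.range (K * M))
    (t := fun t => (prescribed Q F).filter fun f => EntersAt f A c S t))
  have h3 : (∑ t ∈ Finset.range (K * M),
      ((prescribed Q F).filter fun f => EntersAt f A c S t).card) * n ≤
      (K * M) * ((prescribed Q F).card * S.card) := by
    rw [Finset.sum_mul]
    refine (Finset.sum_le_card_nsmul _ _ _ fun t _ => card_entersAt_mul_le hQ F A c t).trans ?_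
    simp
  have h4 := card_late_mul_le hQ F A c hM hA K
  calc _ ≤ (_ + _) * (K * n) := Nat.mul_le_mul_right _ (h1.trans (Nat.add_le_add_right h2 _))
    _ = K * (_ * n) + (_ * K) * n := by ring
    _ ≤ K * _ + _ * n := Nat.add_le_add (Nat.mul_le_mul_left _ h3) (Nat.mul_le_mul_right _ h4)
    _ = _ := by ring

end Counting

end WRPS

namespace WRPS

section MatrixTree

variable {n : ℕ} {ι : Type*} [Fintype ι] [DecidableEq ι] (π : ι → ι) (b : ι → Fin n)

/-- One step of the layered dynamics with transition values `F`. -/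
def layerStep (F : ι × Fin n → Fin n) (w : ι × Fin n) : ι × Fin n := (π w.1, F w)

/-- Every trajectory of the layered dynamics reaches the track `b`. -/
def Drains (F : ι × Fin n → Fin n) : Prop :=
  ∀ w, ∃ j : ℕ, ((layerStep π F)^[j] w).2 = b ((layerStep π F)^[j] w).1

/-- The row attached to the vertex `w` if `w` is mapped to the value `y`. -/
def treeRow (w : ι × Fin n) (y : Fin n) : ι × Fin n → ℝ :=
  if w.2 = b w.1 then (if y = b (π w.1) then Pi.single w 1 else 0)
  else Pi.single w 1 - Pi.single (π w.1, y) 1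

open Classical in
lemma det_treeRow_eq_one {F : ι × Fin n → Fin n} (hF : ∀ x, F (x, b x) = b (π x))
    (hd : Drains π b F) : Matrix.det (Matrix.of fun w => treeRow π b w (F w)) = 1 := by
  set time : ι × Fin n → ℕ := fun w => Nat.find (hd w) with htime
  have hstep : ∀ w, w.2 ≠ b w.1 → time (layerStep π F w) < time w := by
    intro w hw
    have hspec := Nat.find_spec (hd w)
    obtain ⟨k, hk⟩ : ∃ k, time w = k + 1 := by
      refine Nat.exists_eq_succ_of_ne_zero fun h0 => hw ?_
      change ((layerStep π F)^[time w] w).2 = b ((layerStep π F)^[time w] w).1 at hspec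
      rw [h0] at hspec
      exact hspec
    rw [hk, Nat.lt_succ_iff]
    refine Nat.find_min' (hd _) ?_
    change ((layerStep π F)^[time w] w).2 = b ((layerStep π F)^[time w] w).1 at hspec
    rw [hk] at hspec
    exact hspec
  have htri : (Matrix.of fun w => treeRow π b w (F w)).BlockTriangular
      (fun w => OrderDual.toDual (time w)) := by
    intro w v hwv
    have hwv' : time w < time v := hwv
    have hne : v ≠ w := fun h => by rw [h] at hwv'; exact lt_irrefl _ hwv'
    simp only [Matrix.of_apply, treeRow]
    split_ifs with h1 h2
    · simp [hne]
    · rfl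
    · have := hstep w h1
      have hne' : v ≠ (π w.1, F w) := fun h => by
        rw [h] at hwv'
        exact absurd hwv' (not_lt.2 this.le)
      simp [hne, hne']
  rw [htri.det]
  refine Finset.prod_eq_one fun k _ => ?_
  rw [show (Matrix.of fun w => treeRow π b w (F w)).toSquareBlock
    (fun w => OrderDual.toDual (time w)) k = 1 from ?_, Matrix.det_one]
  ext ⟨w, hw⟩ ⟨v, hv⟩
  simp only [Matrix.toSquareBlock_def, Matrix.of_apply, Matrix.one_apply, treeRow, Subtype.mk.injEq]
  have htwv : time w = time v := OrderDual.toDual.injective (hw.trans hv.symm)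
  split_ifs with h1 h2 h3 _ h3
  · subst h3; simp
  · simp [Ne.symm h3]
  · exact absurd (by rw [← hF, ← h1]) h2
  · exact absurd (by rw [← hF, ← h1]) h2
  · subst h3
    have hne : w ≠ (π w.1, F w) := fun h => by
      have := hstep w h1
      rw [layerStep, ← h] at this
      exact lt_irrefl _ this
    simp [hne]
  · have hne : v ≠ (π w.1, F w) := fun h => by
      have := hstep w h1
      rw [layerStep, ← h, htwv] at this
      exact lt_irrefl _ this
    simp [hne, Ne.symm h3]

open Classical in
lemma det_treeRow_eq_zero {F : ι × Fin n → Fin n}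
    (h : ¬ ((∀ x, F (x, b x) = b (π x)) ∧ Drains π b F)) :
    Matrix.det (Matrix.of fun w => treeRow π b w (F w)) = 0 := by
  by_cases hF : ∀ x, F (x, b x) = b (π x)
  · have hd : ¬ Drains π b F := fun hd => h ⟨hF, hd⟩
    simp only [Drains, not_forall] at hd
    obtain ⟨w₀, hw₀⟩ := hd
    refine Matrix.exists_mulVec_eq_zero_iff.1 ⟨fun w =>
      if ∃ j : ℕ, ((layerStep π F)^[j] w).2 = b ((layerStep π F)^[j] w).1 then 0 else 1, ?_, ?_⟩
    · intro h0
      have := congrFun h0 w₀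
      simp only [if_neg hw₀, Pi.zero_apply] at this
      exact one_ne_zero this
    · ext w
      simp only [Matrix.mulVec, Matrix.of_apply, treeRow, Pi.zero_apply]
      split_ifs with h1 h2
      · rw [single_one_dotProduct, if_pos ⟨0, h1⟩]
      · simp
      · rw [sub_dotProduct, single_one_dotProduct, single_one_dotProduct]
        have hiff : (∃ j : ℕ, ((layerStep π F)^[j] w).2 = b ((layerStep π F)^[j] w).1) ↔
            ∃ j : ℕ, ((layerStep π F)^[j] (π w.1, F w)).2 =
              b ((layerStep π F)^[j] (π w.1, F w)).1 := by
          constructor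
          · rintro ⟨j, hj⟩
            cases j with
            | zero => exact absurd hj h1
            | succ j => exact ⟨j, hj⟩
          · rintro ⟨j, hj⟩
            exact ⟨j + 1, hj⟩
        simp only [hiff, sub_self]
  · push Not at hF
    obtain ⟨x, hx⟩ := hF
    refine Matrix.det_eq_zero_of_row_eq_zero (x, b x) fun v => ?_
    simp [treeRow, hx]

open Classical in
lemma card_drains_eq_det :
    ((Finset.univ.filter fun F : ι × Fin n → Fin n =>
      (∀ x, F (x, b x) = b (π x)) ∧ Drains π b F).card : ℝ) =
      Matrix.det (Matrix.of fun w => ∑ y, treeRow π b w y) := by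
  have := (Matrix.detRowAlternating (n := ι × Fin n) (R := ℝ)).toMultilinearMap.map_sum
    (fun w y => treeRow π b w y)
  have h2 : Matrix.det (Matrix.of fun w => ∑ y, treeRow π b w y) =
      ∑ F : ι × Fin n → Fin n, Matrix.det (Matrix.of fun w => treeRow π b w (F w)) := this
  rw [h2, Finset.card_filter]
  push_cast
  refine Finset.sum_congr rfl fun F _ => ?_
  split_ifs with h
  · exact (det_treeRow_eq_one π b h.1 h.2).symm
  · exact (det_treeRow_eq_zero π b h).symm

/-- The matrix of the map `π`. -/
def mapMatrix : Matrix ι ι ℝ := Matrix.of fun x y => if y = π x then 1 else 0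

open Classical in
lemma det_sum_treeRow (hn : 0 < n) :
    Matrix.det (Matrix.of fun w => ∑ y, treeRow π b w y) =
      (n : ℝ) ^ (Fintype.card ι * (n - 1)) *
        Matrix.det (1 - (1 - 1 / (n : ℝ)) • mapMatrix π) := by
  have hn' : (n : ℝ) ≠ 0 := by positivity
  let d : ι × Fin n → ℝ := fun w => if w.2 = b w.1 then 1 else n
  let U : Matrix (ι × Fin n) ι ℝ := Matrix.of fun w z => if w.1 = z ∧ w.2 ≠ b w.1 then 1 else 0
  let V : Matrix ι (ι × Fin n) ℝ := Matrix.of fun z w => if w.1 = π z then 1 / (n : ℝ) else 0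
  have hfac : (Matrix.of fun w => ∑ y, treeRow π b w y) = Matrix.diagonal d * (1 - U * V) := by
    ext w v
    rw [Matrix.diagonal_mul, Matrix.sub_apply, Matrix.mul_apply, Matrix.of_apply,
      Finset.sum_apply]
    have hUV : ∑ z, U w z * V z v = if w.2 = b w.1 then 0 else
        (if v.1 = π w.1 then 1 / (n : ℝ) else 0) := by
      rw [Finset.sum_eq_single w.1]
      · by_cases h : w.2 = b w.1 <;> simp [U, V, h]
      · intro z _ hz; simp [U, Ne.symm hz]
      · simp
    rw [hUV]
    by_cases h : w.2 = b w.1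
    · simp only [treeRow, h, if_true, d, one_mul, sub_zero]
      rw [Finset.sum_eq_single (b (π w.1))]
      · simp [Pi.single_apply, Matrix.one_apply, eq_comm]
      · intro y _ hy; simp [hy]
      · simp
    · simp only [treeRow, h, if_false, d, Pi.sub_apply, Finset.sum_sub_distrib, mul_sub]
      congr 1
      · simp [Pi.single_apply, Matrix.one_apply, eq_comm]
      · by_cases hv : v.1 = π w.1
        · rw [Finset.sum_eq_single v.2]
          · rw [← hv]; simp [hn']
          · intro y _ hy
            have : v ≠ (π w.1, y) := fun h => hy (by rw [h])
            simp [this]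
          · simp
        · rw [Finset.sum_eq_zero]
          · simp [hv]
          · intro y _
            have : v ≠ (π w.1, y) := fun h => hv (by rw [h])
            simp [this]
  have hVU : V * U = (1 - 1 / (n : ℝ)) • mapMatrix π := by
    ext z z'
    rw [Matrix.mul_apply, Fintype.sum_prod_type]
    simp only [V, U, Matrix.of_apply, mapMatrix, Matrix.smul_apply, smul_eq_mul]
    rw [Finset.sum_eq_single (π z)]
    · by_cases h : z' = π z
      · subst h
        simp only [if_true, true_and, mul_ite, mul_one, mul_zero]
        rw [← Finset.sum_filter, Finset.sum_const, Finset.filter_ne', Finset.card_erase_of_mem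
          (Finset.mem_univ _), Finset.card_univ, Fintype.card_fin, nsmul_eq_mul,
          Nat.cast_sub hn]
        field_simp
        simp
      · simp [h, Ne.symm h]
    · intro y _ hy; simp [hy]
    · simp
  have hdiag : Matrix.det (Matrix.diagonal d) = (n : ℝ) ^ (Fintype.card ι * (n - 1)) := by
    rw [Matrix.det_diagonal, Fintype.prod_prod_type]
    have : ∀ x : ι, ∏ c : Fin n, d (x, c) = (n : ℝ) ^ (n - 1) := by
      intro x
      simp only [d]
      rw [Finset.prod_ite, Finset.prod_const_one, one_mul, Finset.prod_const, Finset.filter_ne',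
        Finset.card_erase_of_mem (Finset.mem_univ _), Finset.card_univ, Fintype.card_fin]
    simp only [this, Finset.prod_const, Finset.card_univ]
    rw [← pow_mul, mul_comm]
  rw [hfac, Matrix.det_mul, hdiag, Matrix.det_one_sub_mul_comm, hVU]

end MatrixTree

/-- Counting functions through their restriction along an injection. -/
lemma card_filter_comp {α ι X : Type*} [Fintype α] [Fintype ι] [Fintype X]
    [DecidableEq α] [DecidableEq ι] {a : ι → α} (ha : Function.Injective a)
    (P : (ι → X) → Prop) [DecidablePred P] :
    (Finset.univ.filter fun g : α → X => P (g ∘ a)).card =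
      (Finset.univ.filter P).card * Fintype.card X ^ (Fintype.card α - Fintype.card ι) := by
  classical
  let e : (α → X) ≃ (ι → X) × ({y // y ∉ Set.range a} → X) :=
    (Equiv.piEquivPiSubtypeProd (fun y => y ∈ Set.range a) (fun _ => X)).trans
      ((Equiv.arrowCongr (Equiv.ofInjective a ha).symm (Equiv.refl X)).prodCongr (Equiv.refl _))
  have he : ∀ g, (e g).1 = g ∘ a := fun g => rfl
  have hcard : Fintype.card {y // y ∉ Set.range a} = Fintype.card α - Fintype.card ι := by
    rw [Fintype.card_subtype_compl (fun y => y ∈ Set.range a)]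
    congr 1
    exact (Fintype.card_congr (Equiv.ofInjective a ha)).symm
  rw [← hcard, ← Fintype.card_fun, ← Finset.card_univ (α := {y // y ∉ Set.range a} → X),
    ← Finset.card_product]
  refine Finset.card_equiv e fun g => ?_
  simp [he]

/-- The probability that a uniformly random `n`-state rule satisfies `P`. -/
noncomputable def ruleProb {n : ℕ} (P : CARule n → Prop) : ℝ :=
  (Nat.card {f : CARule n // P f} : ℝ) / (n : ℝ) ^ (n ^ 2)

lemma ruleProb_eq {n : ℕ} (P : CARule n → Prop) [DecidablePred P] :
    ruleProb P = ((Finset.univ.filter P).card : ℝ) / (n : ℝ) ^ (n ^ 2) := by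
  rw [ruleProb, Nat.card_eq_fintype_card, Fintype.card_subtype]

section RuleCount

variable {n : ℕ} {ι : Type*} [Fintype ι] [DecidableEq ι] (π : ι → ι) (a b : ι → Fin n)

/-- The track `b` is a solution driven by the columns through `a`. -/
def HasTrack (f : CARule n) : Prop := ∀ x, f (a x) (b x) = b (π x)

/-- Every chase along the columns through `a` reaches the track `b`. -/
def TrackDecides (f : CARule n) : Prop :=
  ∀ x c, ∃ j : ℕ, chaseSeq f (fun i => a (π^[i] x)) c j = b (π^[j] x)

omit [Fintype ι] [DecidableEq ι] in
lemma layerStep_iterate (f : CARule n) (x : ι) (c : Fin n) (j : ℕ) :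
    (layerStep π fun w => f (a w.1) w.2)^[j] (x, c) =
      (π^[j] x, chaseSeq f (fun i => a (π^[i] x)) c j) := by
  induction j with
  | zero => rfl
  | succ j ih => rw [Function.iterate_succ_apply', Function.iterate_succ_apply', ih]; rfl

omit [Fintype ι] [DecidableEq ι] in
lemma trackDecides_iff_drains (f : CARule n) :
    TrackDecides π a b f ↔ Drains π b fun w => f (a w.1) w.2 := by
  simp only [TrackDecides, Drains, Prod.forall, layerStep_iterate]

/-- The probability that a random rule has the given track and that the track is deciding. -/
lemma card_trackDecides (hn : 0 < n) (ha : Function.Injective a) :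
    ruleProb (fun f : CARule n => HasTrack π a b f ∧ TrackDecides π a b f) =
      Matrix.det (1 - (1 - 1 / (n : ℝ)) • mapMatrix π) / (n : ℝ) ^ Fintype.card ι := by
  classical
  have hn' : (n : ℝ) ≠ 0 := by positivity
  have hs : Fintype.card ι ≤ n := by
    simpa using Fintype.card_le_of_injective a ha
  have h1 := card_filter_comp ha (X := Fin n → Fin n) (fun g : ι → Fin n → Fin n =>
    (∀ x, g x (b x) = b (π x)) ∧ Drains π b fun w => g w.1 w.2)
  have h2 : (Finset.univ.filter fun g : ι → Fin n → Fin n =>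
      (∀ x, g x (b x) = b (π x)) ∧ Drains π b fun w => g w.1 w.2).card =
      (Finset.univ.filter fun F : ι × Fin n → Fin n =>
        (∀ x, F (x, b x) = b (π x)) ∧ Drains π b F).card := by
    refine Finset.card_equiv (Equiv.curry ι (Fin n) (Fin n)).symm fun g => ?_
    simp only [Finset.mem_filter, Finset.mem_univ, true_and]
    rfl
  have h3 : (Finset.univ.filter fun f : CARule n => HasTrack π a b f ∧ TrackDecides π a b f) =
      (Finset.univ.filter fun f : CARule n => (∀ x, (f ∘ a) x (b x) = b (π x)) ∧
        Drains π b fun w => (f ∘ a) w.1 w.2) := by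
    refine Finset.filter_congr fun f _ => ?_
    rw [trackDecides_iff_drains]
    rfl
  rw [ruleProb_eq, h3, show Finset.card _ = _ from h1, h2]
  push_cast
  rw [card_drains_eq_det, det_sum_treeRow π b hn, div_eq_div_iff (by positivity) (by positivity)]
  simp only [Fintype.card_fun, Fintype.card_fin]
  push_cast
  rw [← pow_mul]
  have hexp : Fintype.card ι * (n - 1) + n * (n - Fintype.card ι) + Fintype.card ι = n ^ 2 := by
    obtain ⟨m, rfl⟩ : ∃ m, n = m + 1 := ⟨n - 1, by omega⟩
    obtain ⟨k, hk⟩ := Nat.exists_eq_add_of_le hs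
    simp only [Nat.add_sub_cancel]
    rw [show m + 1 - Fintype.card ι = k by omega]
    have : (m + 1) ^ 2 = (m + 1) * (Fintype.card ι + k) := by rw [← hk]; ring
    rw [this]
    ring
  rw [← hexp, pow_add, pow_add]
  ring

end RuleCount

end WRPS

namespace WRPS

section Probability

variable {n : ℕ}

lemma ruleProb_mono {P R : CARule n → Prop} (h : ∀ f, P f → R f) : ruleProb P ≤ ruleProb R := by
  classical
  rw [ruleProb_eq, ruleProb_eq]
  refine div_le_div_of_nonneg_right ?_ (by positivity)
  exact_mod_cast Finset.card_le_card (Finset.monotone_filter_right _ fun f _ => h f)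

lemma ruleProb_eq_zero {P : CARule n → Prop} (h : ∀ f, ¬ P f) : ruleProb P = 0 := by
  classical
  rw [ruleProb_eq, Finset.filter_false_of_mem fun f _ => h f]
  simp

lemma ruleProb_or_le (P R : CARule n → Prop) :
    ruleProb (fun f => P f ∨ R f) ≤ ruleProb P + ruleProb R := by
  classical
  rw [ruleProb_eq, ruleProb_eq, ruleProb_eq, ← add_div, Finset.filter_or]
  gcongr
  exact_mod_cast Finset.card_union_le _ _

open Classical in
lemma ruleProb_eq_sum (P : CARule n → Prop) :
    ruleProb P = (∑ f, if P f then (1 : ℝ) else 0) / (n : ℝ) ^ (n ^ 2) := by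
  rw [ruleProb_eq, Finset.card_filter]
  push_cast
  rfl

lemma ruleProb_exists_le {α : Type*} (𝒜 : Finset α) (P : α → CARule n → Prop) :
    ruleProb (fun f => ∃ x ∈ 𝒜, P x f) ≤ ∑ x ∈ 𝒜, ruleProb (P x) := by
  classical
  simp only [ruleProb_eq_sum, ← Finset.sum_div]
  rw [Finset.sum_comm]
  gcongr with f
  split_ifs with h
  · obtain ⟨x, hx, hP⟩ := h
    calc (1 : ℝ) = if P x f then 1 else 0 := by rw [if_pos hP]
      _ ≤ _ := Finset.single_le_sum (f := fun x => if P x f then (1 : ℝ) else 0)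
        (fun y _ => by split_ifs <;> norm_num) hx
  · exact Finset.sum_nonneg fun y _ => by split_ifs <;> norm_num

open Classical in
/-- The lower Bonferroni inequality. -/
lemma sum_sub_sum_offDiag_le {α : Type*} (𝒜 : Finset α) (P : α → CARule n → Prop) :
    ∑ x ∈ 𝒜, ruleProb (P x) - ∑ p ∈ 𝒜.offDiag, ruleProb (fun f => P p.1 f ∧ P p.2 f) ≤
      ruleProb (fun f => ∃ x ∈ 𝒜, P x f) := by
  simp only [ruleProb_eq_sum, ← Finset.sum_div]
  rw [Finset.sum_comm, Finset.sum_comm (s := 𝒜.offDiag), ← sub_div, ← Finset.sum_sub_distrib]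
  gcongr with f
  have h0 : ∑ x ∈ 𝒜.offDiag, (if P x.1 f ∧ P x.2 f then (1 : ℝ) else 0) =
      (𝒜.offDiag.filter fun p => P p.1 f ∧ P p.2 f).card := Finset.sum_boole _ _
  rw [Finset.sum_boole]
  have h1 : ∀ [DecidablePred fun p : α × α => P p.1 f ∧ P p.2 f],
      (𝒜.offDiag.filter fun p => P p.1 f ∧ P p.2 f) =
      (𝒜.filter fun x => P x f).offDiag := by
    intro _
    ext p
    simp only [Finset.mem_filter, Finset.mem_offDiag]
    tauto
  rw [h1, Finset.offDiag_card] at h0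
  refine (sub_le_sub_left (le_of_eq_of_le (Eq.symm h0) ?_) _).trans ?_
  · exact Finset.sum_le_sum fun x _ => by split_ifs <;> simp
  set m := (𝒜.filter fun x => P x f).card with hm
  split_ifs with h
  · rw [Nat.cast_sub (Nat.le_mul_self m)]
    push_cast
    nlinarith [sq_nonneg ((m : ℝ) - 1)]
  · have : m = 0 := by
      rw [hm, Finset.card_eq_zero, Finset.filter_eq_empty_iff]
      exact fun x hx hP => h ⟨x, hx, hP⟩
    simp [this]

lemma card_prescribed (Q : Finset (Fin n × Fin n)) (F : CARule n) :
    (prescribed Q F).card * n ^ Q.card = n ^ (n ^ 2) := by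
  classical
  have h1 := card_filter_comp (α := Fin n × Fin n) (ι := Q) (X := Fin n) Subtype.val_injective
    (fun g => ∀ q : Q, g q = F q.1.1 q.1.2)
  have h2 : (Finset.univ.filter fun g : Q → Fin n => ∀ q : Q, g q = F q.1.1 q.1.2).card = 1 := by
    rw [Finset.card_eq_one]
    refine ⟨fun q => F q.1.1 q.1.2, ?_⟩
    ext g
    simp [funext_iff]
  have h3 : (prescribed Q F).card = (Finset.univ.filter fun g : Fin n × Fin n → Fin n =>
      ∀ q : Q, (g ∘ Subtype.val) q = F q.1.1 q.1.2).card := by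
    refine Finset.card_equiv (Equiv.curry (Fin n) (Fin n) (Fin n)).symm fun f => ?_
    simp only [mem_prescribed, Finset.mem_filter, Finset.mem_univ, true_and, Subtype.forall]
    rfl
  have h4 : Q.card ≤ n * n := by
    have := Finset.card_le_univ Q
    simpa using this
  rw [h3, h1, h2, one_mul]
  simp only [Fintype.card_fin, Fintype.card_prod, Fintype.card_coe]
  rw [← pow_add, Nat.sub_add_cancel h4, sq]

end Probability

section Rate

/-- An upper bound for the conditional probability of decision. -/
noncomputable def decisionRate (M n : ℕ) : ℝ := (1 + M) / √n + M / n

lemma tendsto_decisionRate (M : ℕ) : Tendsto (decisionRate M) atTop (nhds 0) := by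
  have h1 : Tendsto (fun n : ℕ => (1 + M : ℝ) / √n) atTop (nhds 0) :=
    (Real.tendsto_sqrt_atTop.comp tendsto_natCast_atTop_atTop).const_div_atTop _
  have h2 : Tendsto (fun n : ℕ => (M : ℝ) / n) atTop (nhds 0) :=
    tendsto_natCast_atTop_atTop.const_div_atTop _
  have h := h1.add h2
  rw [add_zero] at h
  exact h

variable {n : ℕ} {J : Type*} [Fintype J] {M : ℕ}

/-- The number of states of an array. -/
noncomputable def stateCount {J : Type*} (T : J → Fin n) : ℕ := (Set.range T).ncard

open Classical in
lemma stateCount_eq (T : J → Fin n) : stateCount T = (Finset.univ.image T).card := by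
  rw [stateCount, Set.ncard_eq_toFinset_card', Set.toFinset_range]

open Classical in
/-- If there are no more adjacent pairs than states, a state determines its neighbors. -/
lemma neighbors_of_card_pairs_le {T : J → Fin n} {r ρ : J → J}
    {f : CARule n} (hf : ∀ x, f (T x) (T (r x)) = T (ρ x))
    (hc : (Finset.univ.image fun x => (T x, T (r x))).card ≤ stateCount T) {x y : J}
    (hxy : T x = T y) : T (r x) = T (r y) ∧ T (ρ x) = T (ρ y) := by
  rw [stateCount_eq] at hc
  have himg : (Finset.univ.image fun x => (T x, T (r x))).image Prod.fst = Finset.univ.image T := by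
    rw [Finset.image_image]; rfl
  have hinj := Finset.injOn_of_card_image_eq (f := Prod.fst)
    (s := Finset.univ.image fun x => (T x, T (r x)))
    (le_antisymm Finset.card_image_le (by rw [himg]; exact hc))
  have hp : (T x, T (r x)) = (T y, T (r y)) := hinj
    (Finset.mem_coe.2 (Finset.mem_image_of_mem (fun x => (T x, T (r x))) (Finset.mem_univ x)))
    (Finset.mem_coe.2 (Finset.mem_image_of_mem (fun x => (T x, T (r x))) (Finset.mem_univ y))) hxy
  rw [Prod.mk.injEq] at hp
  exact ⟨hp.2, by rw [← hf, ← hf, hp.1, hp.2]⟩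

open Classical in
/-- The probability that an array is a solution for which a given column decides is small. -/
lemma ruleProb_tile_decides_le (T : J → Fin n) (r ρ : J → J) (A : ℕ → Fin n) (hM : 0 < M)
    (hA : ∀ i, A (i + M) = A i) (hn : Fintype.card J < n) :
    ruleProb (fun f => (∀ x, f (T x) (T (r x)) = T (ρ x)) ∧
      ∀ c, ∃ j, chaseSeq f A c j ∈ Set.range T) ≤
      (Fintype.card J * decisionRate M n) /
        (n : ℝ) ^ (Finset.univ.image fun x => (T x, T (r x))).card := by
  have hnpos : 0 < n := by omega
  have hnR : (0 : ℝ) < n := by positivity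
  have hrate : 0 ≤ decisionRate M n := by unfold decisionRate; positivity
  set Q := Finset.univ.image fun x => (T x, T (r x)) with hQ
  set S := Finset.univ.image T with hS
  by_cases hex : ∃ F : CARule n, ∀ x, F (T x) (T (r x)) = T (ρ x)
  swap
  · rw [ruleProb_eq_zero fun f hf => hex ⟨f, hf.1⟩]
    positivity
  obtain ⟨F, hF⟩ := hex
  have hSJ : S.card ≤ Fintype.card J := Finset.card_image_le
  obtain ⟨c, hc⟩ : ∃ c, c ∉ S := by
    by_contra! h
    have : S = Finset.univ := Finset.eq_univ_of_forall h
    rw [this, Finset.card_univ, Fintype.card_fin] at hSJ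
    omega
  have hQS : ∀ p ∈ Q, p.2 ∈ S := by
    intro p hp
    simp only [hQ, hS, Finset.mem_image] at hp ⊢
    obtain ⟨x, -, rfl⟩ := hp
    exact ⟨r x, by simp, rfl⟩
  set K := ⌈√(n : ℝ)⌉₊ with hK
  have hsqrt : 0 < √(n : ℝ) := Real.sqrt_pos.2 hnR
  have hK1 : √(n : ℝ) ≤ K := Nat.le_ceil _
  have hK2 : (K : ℝ) ≤ √n + 1 := (Nat.ceil_lt_add_one hsqrt.le).le
  have hKpos : (0 : ℝ) < K := hsqrt.trans_le hK1
  have hmain := card_enters_mul_le hQS F A c hc hM hA K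
  set E := (prescribed Q F).filter fun f => ∃ j, chaseSeq f A c j ∈ S with hE
  have hsub : (Finset.univ.filter fun f : CARule n => (∀ x, f (T x) (T (r x)) = T (ρ x)) ∧
      ∀ c, ∃ j, chaseSeq f A c j ∈ Set.range T) ⊆ E := by
    intro f hf
    simp only [Finset.mem_filter, Finset.mem_univ, true_and] at hf
    rw [hE, Finset.mem_filter, mem_prescribed]
    refine ⟨fun p hp => ?_, ?_⟩
    · simp only [hQ, Finset.mem_image] at hp
      obtain ⟨x, -, rfl⟩ := hp
      rw [hf.1, hF]
    · obtain ⟨j, hj⟩ := hf.2 c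
      exact ⟨j, by simpa [hS] using hj⟩
  have hmainR : (E.card : ℝ) * (K * n) ≤
      (prescribed Q F).card * S.card * (K * (K * M) + n) := by exact_mod_cast hmain
  have hcard : ((prescribed Q F).card : ℝ) * (n : ℝ) ^ Q.card = (n : ℝ) ^ (n ^ 2) := by
    exact_mod_cast card_prescribed Q F
  have hrate2 : ((K : ℝ) * (K * M) + n) / (K * n) ≤ decisionRate M n := by
    have h1 : ((K : ℝ) * (K * M) + n) / (K * n) = K * M / n + 1 / K := by
      field_simp
    have h2 : (K : ℝ) * M / n ≤ (√n + 1) * M / n := by gcongr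
    have h3 : (1 : ℝ) / K ≤ 1 / √n := by gcongr
    have h4 : √(n : ℝ) / n = 1 / √n := by
      rw [div_eq_div_iff hnR.ne' hsqrt.ne', Real.mul_self_sqrt hnR.le, one_mul]
    calc _ = (K : ℝ) * M / n + 1 / K := h1
      _ ≤ (√n + 1) * M / n + 1 / √n := add_le_add h2 h3
      _ = M * (√n / n) + M / n + 1 / √n := by ring
      _ = decisionRate M n := by rw [h4, decisionRate]; ring
  rw [ruleProb_eq, div_le_div_iff₀ (by positivity) (by positivity), ← hcard]
  have hEle : (E.card : ℝ) ≤ (prescribed Q F).card * (Fintype.card J * decisionRate M n) := by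
    have : (E.card : ℝ) ≤ (prescribed Q F).card * S.card * ((K * (K * M) + n) / (K * n)) := by
      rw [← mul_div_assoc, le_div_iff₀ (by positivity)]
      exact hmainR
    refine this.trans ?_
    rw [mul_assoc]
    gcongr
  calc _ ≤ (E.card : ℝ) * (n : ℝ) ^ Q.card := by
        gcongr
    _ ≤ ((prescribed Q F).card * (Fintype.card J * decisionRate M n)) * (n : ℝ) ^ Q.card := by
        gcongr
    _ = _ := by ring

/-- The weights `n ^ (- s(T))` of all arrays `T` have bounded total mass. -/
lemma sum_stateCount_le (hn : 0 < n) [DecidableEq J] :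
    ∑ T : J → Fin n, 1 / (n : ℝ) ^ stateCount T ≤ Nat.card (Setoid J) := by
  classical
  have : Finite (Setoid J) := Finite.of_injective (fun s : Setoid J => s.r) fun s t h =>
    Setoid.ext fun a b => by rw [show s.r = t.r from h]
  have := Fintype.ofFinite (Setoid J)
  rw [← Finset.sum_fiberwise (s := Finset.univ) (g := fun T : J → Fin n => Setoid.ker T),
    Nat.card_eq_fintype_card, ← Finset.card_univ, Finset.card_eq_sum_ones, Nat.cast_sum]
  refine Finset.sum_le_sum fun s _ => ?_
  have hs : ∀ T ∈ Finset.univ.filter (fun T : J → Fin n => Setoid.ker T = s),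
      stateCount T = Fintype.card (Quotient s) := by
    intro T hT
    rw [Finset.mem_filter] at hT
    rw [← hT.2, stateCount, ← Nat.card_coe_set_eq, Nat.card_eq_fintype_card]
    exact (Fintype.card_congr (Setoid.quotientKerEquivRange T)).symm
  rw [Finset.sum_congr rfl fun T hT => by rw [hs T hT], Finset.sum_const, nsmul_eq_mul]
  have hle : (Finset.univ.filter (fun T : J → Fin n => Setoid.ker T = s)).card ≤
      n ^ Fintype.card (Quotient s) := by
    rw [show n ^ Fintype.card (Quotient s) = (Finset.univ : Finset (Quotient s → Fin n)).card by
      simp]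
    refine Finset.card_le_card_of_injOn (fun T x => T x.out) (by simp) ?_
    intro T hT T' hT' h
    simp only [Finset.coe_filter, Finset.mem_univ, true_and, Set.mem_ofPred_eq] at hT hT'
    ext1 x
    have hout : s x (Quotient.mk s x).out := Setoid.symm (Quotient.mk_out x)
    have hker : ∀ {R : J → Fin n}, Setoid.ker R = s → ∀ {y z}, s y z → R y = R z := by
      rintro R rfl y z h
      exact h
    rw [hker hT hout, hker hT' hout]
    exact congrFun h _
  rw [mul_one_div, Nat.cast_one, div_le_one (by positivity)]
  exact_mod_cast hle

end Rate

end WRPS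

namespace WRPS

section DrainDet

variable {κ κ' : Type*} [Fintype κ] [DecidableEq κ] [Fintype κ'] [DecidableEq κ']

/-- The determinant governing the probability that a track is deciding. -/
noncomputable def drainDet (π : κ → κ) (q : ℝ) : ℝ := Matrix.det (1 - q • mapMatrix π)

lemma drainDet_one [Nonempty κ] (π : κ → κ) : drainDet π 1 = 0 := by
  refine Matrix.exists_mulVec_eq_zero_iff.1 ⟨fun _ => 1, fun h => ?_, ?_⟩
  · exact one_ne_zero (congrFun h (Classical.arbitrary κ))
  · ext x
    simp [mapMatrix, Matrix.mulVec, dotProduct, Matrix.one_apply]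

lemma exists_tendsto_mul_drainDet [Nonempty κ] (π : κ → κ) :
    ∃ d, Tendsto (fun n : ℕ => (n : ℝ) * drainDet π (1 - 1 / n)) atTop (nhds d) := by
  have hd : DifferentiableAt ℝ (fun t => drainDet π (1 - t)) 0 := by
    simp only [drainDet, Matrix.det_apply, Matrix.sub_apply, Matrix.smul_apply]
    fun_prop
  refine ⟨_, ((hasDerivAt_iff_tendsto_slope.1 hd.hasDerivAt).comp
    (f := fun n : ℕ => 1 / (n : ℝ)) (x := atTop) ?_).congr' ?_⟩
  · refine tendsto_nhdsWithin_iff.2 ⟨tendsto_one_div_atTop_nhds_zero_nat, ?_⟩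
    filter_upwards [eventually_gt_atTop 0] with n hn
    simp [hn.ne']
  · filter_upwards [eventually_gt_atTop 0] with n hn
    simp [slope_def_field, drainDet_one]
    ring

lemma drainDet_sum_map (π : κ → κ) (π' : κ' → κ') (q : ℝ) :
    drainDet (Sum.map π π') q = drainDet π q * drainDet π' q := by
  rw [drainDet, drainDet, drainDet, ← Matrix.det_fromBlocks_zero₂₁ _ 0]
  congr 1
  ext (x | x) (y | y) <;> simp [mapMatrix, Matrix.one_apply]

lemma tendsto_mul_abs_drainDet_mul [Nonempty κ] [Nonempty κ'] (π : κ → κ) (π' : κ' → κ') :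
    Tendsto (fun n : ℕ => (n : ℝ) * |drainDet π (1 - 1 / n) * drainDet π' (1 - 1 / n)|)
      atTop (nhds 0) := by
  obtain ⟨d, hd⟩ := exists_tendsto_mul_drainDet π
  obtain ⟨d', hd'⟩ := exists_tendsto_mul_drainDet π'
  have h := ((hd.mul hd').abs).mul (tendsto_one_div_atTop_nhds_zero_nat (𝕜 := ℝ))
  rw [mul_zero] at h
  refine h.congr' ?_
  filter_upwards [eventually_gt_atTop 0] with n hn
  have hn' : (0 : ℝ) < n := by exact_mod_cast hn
  rw [mul_mul_mul_comm, abs_mul, abs_of_pos (mul_pos hn' hn')]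
  field_simp

end DrainDet

section TrackSum

variable {n : ℕ} {κ κ' : Type*} (π : κ → κ) (π' : κ' → κ') (a b : κ → Fin n) (a' b' : κ' → Fin n)
  (f : CARule n)

lemma hasTrack_sum : HasTrack (Sum.map π π') (Sum.elim a a') (Sum.elim b b') f ↔
    HasTrack π a b f ∧ HasTrack π' a' b' f := by
  simp [HasTrack]

lemma trackDecides_sum : TrackDecides (Sum.map π π') (Sum.elim a a') (Sum.elim b b') f ↔
    TrackDecides π a b f ∧ TrackDecides π' a' b' f := by
  have hl : ∀ i x, (Sum.map π π')^[i] (Sum.inl x) = Sum.inl (π^[i] x) := fun i x => by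
    induction i with
    | zero => rfl
    | succ i ih => simp only [Function.iterate_succ_apply', ih, Sum.map_inl]
  have hr : ∀ i x, (Sum.map π π')^[i] (Sum.inr x) = Sum.inr (π'^[i] x) := fun i x => by
    induction i with
    | zero => rfl
    | succ i ih => simp only [Function.iterate_succ_apply', ih, Sum.map_inr]
  simp only [TrackDecides, Sum.forall, hl, hr, Sum.elim_inl, Sum.elim_inr]

end TrackSum

section Kernel

variable {n M : ℕ}

/-- Two sites of the array `T` carry the same state exactly when they agree modulo `L`. -/
def HasKernel (T : ZMod M × ZMod M → Fin n) (L : AddSubgroup (ZMod M × ZMod M)) : Prop :=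
  ∀ g h, T g = T h ↔ (g : (ZMod M × ZMod M) ⧸ L) = h

/-- A relation that propagates to both neighbors is translation invariant. -/
lemma propagate [NeZero M] {R : ZMod M × ZMod M → ZMod M × ZMod M → Prop}
    (hR : ∀ g h, R g h → R (g + (0, 1)) (h + (0, 1)) ∧ R (g + (1, 1)) (h + (1, 1)))
    {g h : ZMod M × ZMod M} (hgh : R g h) (u : ZMod M × ZMod M) : R (g + u) (h + u) := by
  have h1 : ∀ k : ℕ, R (g + k • (1, 1)) (h + k • (1, 1)) := fun k => by
    induction k with
    | zero => simpa using hgh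
    | succ k ih => simpa only [succ_nsmul, add_assoc] using (hR _ _ ih).2
  have h2 : ∀ k m : ℕ, R (g + k • (1, 1) + m • (0, 1)) (h + k • (1, 1) + m • (0, 1)) :=
    fun k m => by
      induction m with
      | zero => simpa using h1 k
      | succ m ih => simpa only [succ_nsmul, add_assoc] using (hR _ _ ih).1
  have hu : u.1.val • ((1, 1) : ZMod M × ZMod M) + (u.2 - u.1).val • ((0, 1) : ZMod M × ZMod M)
      = u := by
    ext <;> simp
  have h3 := h2 u.1.val (u.2 - u.1).val
  rwa [add_assoc, add_assoc, hu] at h3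

lemma exists_hasKernel [NeZero M] {T : ZMod M × ZMod M → Fin n}
    (hT : ∀ g h, T g = T h → T (g + (0, 1)) = T (h + (0, 1)) ∧ T (g + (1, 1)) = T (h + (1, 1))) :
    ∃ L, HasKernel T L := by
  have key : ∀ {g h}, T g = T h → ∀ u, T (g + u) = T (h + u) :=
    fun hgh => propagate (R := fun g h => T g = T h) hT hgh
  refine ⟨{ carrier := {u | T u = T 0}, zero_mem' := rfl, add_mem' := ?_, neg_mem' := ?_ }, ?_⟩
  · intro u v hu hv
    exact (key hu v).trans (by rw [zero_add]; exact hv)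
  · intro u hu
    have := key hu (-u)
    rw [add_neg_cancel, zero_add] at this
    exact this.symm
  · intro g h
    rw [QuotientAddGroup.eq]
    change _ ↔ T (-g + h) = T 0
    constructor
    · intro e
      have := key e (-g)
      rw [add_neg_cancel, add_comm h] at this
      exact this.symm
    · intro e
      have := key e g
      rw [zero_add, neg_add_cancel_comm] at this
      exact this.symm

lemma HasKernel.mem_iff {T : ZMod M × ZMod M → Fin n} {L : AddSubgroup (ZMod M × ZMod M)}
    (hT : HasKernel T L) (g u : ZMod M × ZMod M) : T (g + u) = T g ↔ u ∈ L := by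
  rw [eq_comm, hT, QuotientAddGroup.eq, neg_add_cancel_left]

lemma HasKernel.unique {T : ZMod M × ZMod M → Fin n} {L L' : AddSubgroup (ZMod M × ZMod M)}
    (hT : HasKernel T L) (hT' : HasKernel T L') : L = L' := by
  ext u
  rw [← hT.mem_iff 0, hT'.mem_iff]

lemma HasKernel.translate {T : ZMod M × ZMod M → Fin n} {L : AddSubgroup (ZMod M × ZMod M)}
    (hT : HasKernel T L) (u : ZMod M × ZMod M) : HasKernel (fun g => T (u + g)) L := fun g h => by
  rw [hT, QuotientAddGroup.eq, QuotientAddGroup.eq]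
  congr! 1
  abel

/-- The analogue of `HasPeriodsIn` for the kernel of an array. -/
def LatticePeriods (𝒯 𝒮 : Finset ℕ) (L : AddSubgroup (ZMod M × ZMod M)) : Prop :=
  ∃ τ ∈ 𝒯, ∃ σ ∈ 𝒮, 0 < τ ∧ 0 < σ ∧
    ((τ : ZMod M), (0 : ZMod M)) ∈ L ∧
    (∀ τ' : ℕ, 0 < τ' → ((τ' : ZMod M), (0 : ZMod M)) ∈ L → τ ≤ τ') ∧
    ((0 : ZMod M), (σ : ZMod M)) ∈ L ∧
    (∀ σ' : ℕ, 0 < σ' → ((0 : ZMod M), (σ' : ZMod M)) ∈ L → σ ≤ σ')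

lemma HasKernel.hasPeriodsIn_iff {𝒯 𝒮 : Finset ℕ} {T : ZMod M × ZMod M → Fin n}
    {L : AddSubgroup (ZMod M × ZMod M)} (hT : HasKernel T L) :
    HasPeriodsIn 𝒯 𝒮 T ↔ LatticePeriods 𝒯 𝒮 L := by
  simp only [HasPeriodsIn, LatticePeriods, hT.mem_iff, forall_const]

/-- The temporal shift on the quotient by `L`. -/
def quotShift (L : AddSubgroup (ZMod M × ZMod M)) (x : (ZMod M × ZMod M) ⧸ L) :
    (ZMod M × ZMod M) ⧸ L := x + ((1, 0) : ZMod M × ZMod M)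

/-- The function induced by `T` on the quotient by `L`. -/
noncomputable def quotArray (T : ZMod M × ZMod M → Fin n) (L : AddSubgroup (ZMod M × ZMod M))
    (x : (ZMod M × ZMod M) ⧸ L) : Fin n := T x.out

/-- The right neighbors in the array induced by `T` on the quotient by `L`. -/
noncomputable def quotNext (T : ZMod M × ZMod M → Fin n) (L : AddSubgroup (ZMod M × ZMod M))
    (x : (ZMod M × ZMod M) ⧸ L) : Fin n := quotArray T L (x + ((0, 1) : ZMod M × ZMod M))

variable {T : ZMod M × ZMod M → Fin n} {L : AddSubgroup (ZMod M × ZMod M)}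

lemma HasKernel.quotArray_mk (hT : HasKernel T L) (g : ZMod M × ZMod M) :
    quotArray T L g = T g := by
  rw [quotArray, hT]
  exact Quotient.out_eq' _

lemma HasKernel.quotArray_injective (hT : HasKernel T L) :
    Function.Injective (quotArray T L) := by
  intro x y
  induction x using QuotientAddGroup.induction_on with | H g =>
  induction y using QuotientAddGroup.induction_on with | H h =>
  rw [hT.quotArray_mk, hT.quotArray_mk]
  exact (hT g h).1

lemma HasKernel.quotNext_mk (hT : HasKernel T L) (g : ZMod M × ZMod M) :
    quotNext T L g = T (g + (0, 1)) := by
  rw [quotNext, ← QuotientAddGroup.mk_add, hT.quotArray_mk]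

lemma quotShift_iterate (g : ZMod M × ZMod M) (i : ℕ) :
    (quotShift L)^[i] g = ((g + ((i : ZMod M), 0) : ZMod M × ZMod M) : (ZMod M × ZMod M) ⧸ L) := by
  induction i with
  | zero => simp [← Prod.zero_eq_mk]
  | succ i ih =>
    rw [Function.iterate_succ_apply', ih, quotShift, ← QuotientAddGroup.mk_add, add_assoc]
    simp

lemma HasKernel.hasTrack_iff (hT : HasKernel T L) (f : CARule n) :
    HasTrack (quotShift L) (quotArray T L) (quotNext T L) f ↔ IsTile f T := by
  have key : ∀ g : ZMod M × ZMod M,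
      quotNext T L (quotShift L g) = T (g + (1, 1)) := fun g => by
    rw [quotShift, ← QuotientAddGroup.mk_add, hT.quotNext_mk, add_assoc]
    simp
  constructor
  · intro h g
    have := h g
    rwa [key, hT.quotArray_mk, hT.quotNext_mk] at this
  · intro h x
    induction x using QuotientAddGroup.induction_on with | H g =>
    rw [key, hT.quotArray_mk, hT.quotNext_mk, h]

lemma HasKernel.trackDecides_iff (hT : HasKernel T L) (f : CARule n) :
    TrackDecides (quotShift L) (quotArray T L) (quotNext T L) f ↔ ColumnsDecide f T := by
  have key : ∀ (g : ZMod M × ZMod M) c, (∃ j, chaseSeq f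
      (fun i => quotArray T L ((quotShift L)^[i] g)) c j = quotNext T L ((quotShift L)^[j] g)) ↔
      ∃ j : ℕ, chaseSeq f (fun i => T (g + ((i : ZMod M), 0))) c j = T (g + ((j : ZMod M), 1)) := by
    intro g c
    simp only [quotShift_iterate, hT.quotArray_mk, hT.quotNext_mk, add_assoc, Prod.mk_add_mk,
      add_zero, zero_add]
  constructor
  · intro h g c
    exact (key g c).1 (h g c)
  · intro h x c
    induction x using QuotientAddGroup.induction_on with | H g =>
    exact (key g c).2 (h g c)

variable [NeZero M]

open Classical in
/-- The determinant governing the probability that an array with kernel `L` is deciding. -/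
noncomputable def kernelDet (L : AddSubgroup (ZMod M × ZMod M)) (n : ℕ) : ℝ :=
  drainDet (quotShift L) (1 - 1 / n)

open Classical in
lemma HasKernel.ruleProb_eq (hn : 0 < n) (hT : HasKernel T L) :
    ruleProb (fun f => IsTile f T ∧ ColumnsDecide f T) =
      kernelDet L n / (n : ℝ) ^ Fintype.card ((ZMod M × ZMod M) ⧸ L) := by
  rw [kernelDet, drainDet, ← card_trackDecides (quotShift L) (quotArray T L) (quotNext T L) hn
    hT.quotArray_injective]
  simp only [hT.hasTrack_iff, hT.trackDecides_iff]

open Classical in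
lemma HasKernel.ruleProb_pair_eq (hn : 0 < n) (hT : HasKernel T L) {T' : ZMod M × ZMod M → Fin n}
    {L' : AddSubgroup (ZMod M × ZMod M)} (hT' : HasKernel T' L') (hdisj : ∀ g h, T g ≠ T' h) :
    ruleProb (fun f => (IsTile f T ∧ ColumnsDecide f T) ∧ IsTile f T' ∧ ColumnsDecide f T') =
      kernelDet L n * kernelDet L' n / (n : ℝ) ^
        (Fintype.card ((ZMod M × ZMod M) ⧸ L) + Fintype.card ((ZMod M × ZMod M) ⧸ L')) := by
  have hinj : Function.Injective (Sum.elim (quotArray T L) (quotArray T' L')) :=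
    hT.quotArray_injective.sumElim hT'.quotArray_injective fun x y => hdisj _ _
  rw [kernelDet, kernelDet, ← drainDet_sum_map, drainDet, ← Fintype.card_sum,
    ← card_trackDecides _ _ (Sum.elim (quotNext T L) (quotNext T' L')) hn hinj]
  simp only [hasTrack_sum, trackDecides_sum, hT.hasTrack_iff, hT.trackDecides_iff,
    hT'.hasTrack_iff, hT'.trackDecides_iff]
  congr 1
  ext f
  tauto

end Kernel

end WRPS

namespace WRPS

section Counting

open Classical in
/-- By symmetry, each point carries the minimum for the same number of embeddings. -/
lemma card_mul_card_minimal_embeddings {κ : Type*} [Fintype κ] (k : κ) (n : ℕ) :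
    Fintype.card κ * (Finset.univ.filter fun e : κ ↪ Fin n => ∀ j, e k ≤ e j).card =
      n.descFactorial (Fintype.card κ) := by
  have hsym : ∀ l : κ, (Finset.univ.filter fun e : κ ↪ Fin n => ∀ j, e l ≤ e j).card =
      (Finset.univ.filter fun e : κ ↪ Fin n => ∀ j, e k ≤ e j).card := by
    intro l
    refine Finset.card_equiv (Equiv.embeddingCongr (Equiv.swap k l) (Equiv.refl _)) fun e => ?_
    simp only [Finset.mem_filter, Finset.mem_univ, true_and]
    have happ : ∀ j, (Equiv.embeddingCongr (Equiv.swap k l) (Equiv.refl (Fin n)) e) j =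
        e (Equiv.swap k l j) := fun j => by simp
    simp only [happ, Equiv.swap_apply_left]
    exact ((Equiv.swap k l).forall_congr_left).trans (by simp)
  have : Nonempty κ := ⟨k⟩
  calc _ = ∑ l : κ, (Finset.univ.filter fun e : κ ↪ Fin n => ∀ j, e l ≤ e j).card := by
        simp only [hsym, Finset.sum_const, Finset.card_univ, smul_eq_mul]
    _ = ((Finset.univ : Finset κ).biUnion fun l =>
          Finset.univ.filter fun e : κ ↪ Fin n => ∀ j, e l ≤ e j).card := by
        refine (Finset.card_biUnion fun l _ m _ hlm => ?_).symm
        refine Finset.disjoint_left.2 fun e he he' => ?_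
        simp only [Finset.mem_filter, Finset.mem_univ, true_and] at he he'
        exact hlm (e.injective (le_antisymm (he m) (he' l)))
    _ = (Finset.univ : Finset (κ ↪ Fin n)).card := by
        congr 1
        refine Finset.eq_univ_of_forall fun e => ?_
        obtain ⟨l, hl⟩ := Finite.exists_min e
        simpa using ⟨l, hl⟩
    _ = _ := by rw [Finset.card_univ, Fintype.card_embedding_eq, Fintype.card_fin]

variable {M : ℕ} [NeZero M]

open Classical in
/-- The arrays with kernel `L` whose smallest state is at the origin. -/
noncomputable def normalizedArrays (L : AddSubgroup (ZMod M × ZMod M)) (n : ℕ) :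
    Finset (ZMod M × ZMod M → Fin n) :=
  Finset.univ.filter fun T => HasKernel T L ∧ ∀ g, T 0 ≤ T g

lemma mem_normalizedArrays {L : AddSubgroup (ZMod M × ZMod M)} {n : ℕ}
    {T : ZMod M × ZMod M → Fin n} :
    T ∈ normalizedArrays L n ↔ HasKernel T L ∧ ∀ g, T 0 ≤ T g := by
  simp [normalizedArrays]

open Classical in
lemma card_mul_card_normalizedArrays (L : AddSubgroup (ZMod M × ZMod M)) (n : ℕ) :
    Fintype.card ((ZMod M × ZMod M) ⧸ L) * (normalizedArrays L n).card =
      n.descFactorial (Fintype.card ((ZMod M × ZMod M) ⧸ L)) := by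
  rw [← card_mul_card_minimal_embeddings ((0 : ZMod M × ZMod M) : (ZMod M × ZMod M) ⧸ L) n]
  congr 1
  symm
  refine Finset.card_bij (fun e _ g => e g) ?_ ?_ ?_
  · intro e he
    simp only [Finset.mem_filter, Finset.mem_univ, true_and] at he
    exact mem_normalizedArrays.2 ⟨fun g h => e.injective.eq_iff, fun g => he g⟩
  · intro e _ e' _ h
    ext1 x
    induction x using QuotientAddGroup.induction_on with | H g =>
    exact congrFun h g
  · intro T hT
    obtain ⟨hT, hmin⟩ := mem_normalizedArrays.1 hT
    refine ⟨⟨quotArray T L, hT.quotArray_injective⟩, ?_, ?_⟩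
    · simp only [Finset.mem_filter, Finset.mem_univ, true_and, Function.Embedding.coeFn_mk]
      intro x
      induction x using QuotientAddGroup.induction_on with | H g =>
      rw [hT.quotArray_mk, hT.quotArray_mk]
      exact hmin g
    · ext1 g
      exact hT.quotArray_mk g

open Classical in
lemma exists_tendsto_mul_sum_normalizedArrays (L : AddSubgroup (ZMod M × ZMod M)) :
    ∃ c, Tendsto (fun n : ℕ => (n : ℝ) * ∑ T ∈ normalizedArrays L n,
      ruleProb (fun f => IsTile f T ∧ ColumnsDecide f T)) atTop (nhds c) := by
  set s := Fintype.card ((ZMod M × ZMod M) ⧸ L) with hs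
  have hspos : (0 : ℝ) < s := by exact_mod_cast Fintype.card_pos
  obtain ⟨d, hd⟩ := exists_tendsto_mul_drainDet (quotShift L)
  have h1 : Tendsto (fun n : ℕ => (n.descFactorial s : ℝ) / (n : ℝ) ^ s) atTop (nhds 1) := by
    refine (Asymptotics.isEquivalent_iff_tendsto_one ?_).1 (isEquivalent_descFactorial s)
    filter_upwards [eventually_gt_atTop 0] with n hn
    positivity
  refine ⟨_, ((h1.div_const (s : ℝ)).mul hd).congr' ?_⟩
  filter_upwards [eventually_gt_atTop 0] with n hn
  rw [Finset.sum_congr rfl fun T hT => (mem_normalizedArrays.1 hT).1.ruleProb_eq hn,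
    Finset.sum_const, nsmul_eq_mul, ← card_mul_card_normalizedArrays L n, ← hs]
  rw [← kernelDet]
  push_cast
  field_simp

end Counting

end WRPS

namespace WRPS

section Estimates

variable {n M : ℕ}

open Classical in
/-- An array with more adjacent pairs than states contributes at a lower order. -/
lemma ruleProb_le_of_stateCount_lt {J : Type*} [Fintype J] {T : J → Fin n} {r : J → J} (ρ : J → J)
    {A : ℕ → Fin n} (hM : 0 < M) (hA : ∀ i, A (i + M) = A i) (hn : Fintype.card J < n)
    (hlt : stateCount T < (Finset.univ.image fun x => (T x, T (r x))).card) :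
    ruleProb (fun f => (∀ x, f (T x) (T (r x)) = T (ρ x)) ∧
      ∀ c, ∃ j, chaseSeq f A c j ∈ Set.range T) ≤
      1 / (n : ℝ) ^ stateCount T * (Fintype.card J * decisionRate M n / n) := by
  have hn1 : (1 : ℝ) ≤ n := by exact_mod_cast (show 1 ≤ n by omega)
  have hn0 : (0 : ℝ) < n := by linarith
  have hrate : 0 ≤ decisionRate M n := by unfold decisionRate; positivity
  refine (ruleProb_tile_decides_le T r ρ A hM hA hn).trans ?_
  calc _ ≤ (Fintype.card J * decisionRate M n) / (n : ℝ) ^ (stateCount T + 1) := by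
        gcongr
        exact hlt
    _ = _ := by rw [pow_succ]; field_simp

/-- The first column of an array. -/
def column (T : ZMod M × ZMod M → Fin n) (i : ℕ) : Fin n := T ((i : ZMod M), 0)

lemma column_periodic (T : ZMod M × ZMod M → Fin n) (i : ℕ) :
    column T (i + M) = column T i := by
  simp [column]

/-- The first column of `T` is chased back to `T` from any state. -/
lemma ColumnsDecide.exists_mem_range {f : CARule n} {T : ZMod M × ZMod M → Fin n}
    (h : ColumnsDecide f T) (c : Fin n) :
    ∃ j, chaseSeq f (column T) c j ∈ Set.range T := by
  obtain ⟨j, hj⟩ := h 0 c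
  simp only [zero_add] at hj
  exact ⟨j, _, hj.symm⟩

variable [NeZero M]

lemma ruleProb_le_of_not_hasKernel {T : ZMod M × ZMod M → Fin n}
    (hn : Fintype.card (ZMod M × ZMod M) < n) (hT : ¬ ∃ L, HasKernel T L) :
    ruleProb (fun f => IsTile f T ∧ ColumnsDecide f T) ≤
      1 / (n : ℝ) ^ stateCount T * (Fintype.card (ZMod M × ZMod M) * decisionRate M n / n) := by
  classical
  by_cases hlt : stateCount T < (Finset.univ.image fun x => (T x, T (x + (0, 1)))).card
  · refine (ruleProb_mono fun f hf => ?_).trans (ruleProb_le_of_stateCount_lt (· + (1, 1))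
      (NeZero.pos M) (column_periodic T) hn hlt)
    exact ⟨hf.1, hf.2.exists_mem_range⟩
  · rw [ruleProb_eq_zero]
    · unfold decisionRate
      positivity
    · intro f hf
      exact hT (exists_hasKernel fun g h hgh =>
        neighbors_of_card_pairs_le hf.1 (not_lt.1 hlt) hgh)

open Classical in
lemma HasKernel.stateCount_le {T : ZMod M × ZMod M → Fin n} {L : AddSubgroup (ZMod M × ZMod M)}
    (hT : HasKernel T L) : stateCount T ≤ Fintype.card ((ZMod M × ZMod M) ⧸ L) := by
  have : Set.range T ⊆ Set.range (quotArray T L) := by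
    rintro _ ⟨g, rfl⟩
    exact ⟨g, hT.quotArray_mk g⟩
  refine (Set.ncard_le_ncard this (Set.toFinite _)).trans ?_
  rw [← Set.image_univ]
  refine (Set.ncard_image_le (Set.toFinite _)).trans ?_
  rw [Set.ncard_univ, Nat.card_eq_fintype_card]

lemma stateCount_sum_le {J J' : Type*} (T : J → Fin n) (T' : J' → Fin n) :
    stateCount (Sum.elim T T') ≤ stateCount T + stateCount T' := by
  rw [stateCount, Set.Sum.elim_range]
  exact Set.ncard_union_le _ _

/-- The total contribution of pairs of kernels. -/
noncomputable def drainPairs (M : ℕ) [NeZero M] (n : ℕ) : ℝ :=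
  ∑ p : AddSubgroup (ZMod M × ZMod M) × AddSubgroup (ZMod M × ZMod M),
    |kernelDet p.1 n * kernelDet p.2 n|

lemma drainPairs_nonneg (n : ℕ) : 0 ≤ drainPairs M n :=
  Finset.sum_nonneg fun _ _ => abs_nonneg _

lemma abs_kernelDet_mul_le (L L' : AddSubgroup (ZMod M × ZMod M)) (n : ℕ) :
    |kernelDet L n * kernelDet L' n| ≤
      drainPairs M n := by
  have h := Finset.single_le_sum (f := fun p : AddSubgroup (ZMod M × ZMod M) ×
    AddSubgroup (ZMod M × ZMod M) => |kernelDet p.1 n * kernelDet p.2 n|)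
    (fun p _ => abs_nonneg _) (Finset.mem_univ (L, L'))
  exact h

open Classical in
lemma tendsto_mul_drainPairs :
    Tendsto (fun n : ℕ => (n : ℝ) * drainPairs M n) atTop (nhds 0) := by
  simp only [drainPairs, Finset.mul_sum]
  rw [← Finset.sum_const_zero]
  exact tendsto_finsetSum _ fun p _ => tendsto_mul_abs_drainDet_mul _ _

lemma ruleProb_pair_le {T T' : ZMod M × ZMod M → Fin n} {L L' : AddSubgroup (ZMod M × ZMod M)}
    (hn : Fintype.card ((ZMod M × ZMod M) ⊕ (ZMod M × ZMod M)) < n)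
    (hT : T ∈ normalizedArrays L n) (hT' : T' ∈ normalizedArrays L' n) (hne : T ≠ T') :
    ruleProb (fun f => (IsTile f T ∧ ColumnsDecide f T) ∧ IsTile f T' ∧ ColumnsDecide f T') ≤
      1 / (n : ℝ) ^ stateCount (Sum.elim T T') *
        (Fintype.card ((ZMod M × ZMod M) ⊕ (ZMod M × ZMod M)) * decisionRate M n / n +
          drainPairs M n) := by
  classical
  obtain ⟨hT, hmin⟩ := mem_normalizedArrays.1 hT
  obtain ⟨hT', hmin'⟩ := mem_normalizedArrays.1 hT'
  have hn1 : (1 : ℝ) ≤ n := by exact_mod_cast (show 1 ≤ n by omega)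
  have hn0 : (0 : ℝ) < n := by linarith
  have hrate : 0 ≤ decisionRate M n := by unfold decisionRate; positivity
  have hpairs := drainPairs_nonneg (M := M) n
  set S := Sum.elim T T' with hS
  set r : (ZMod M × ZMod M) ⊕ (ZMod M × ZMod M) → (ZMod M × ZMod M) ⊕ (ZMod M × ZMod M) :=
    Sum.map (· + (0, 1)) (· + (0, 1)) with hr
  set ρ : (ZMod M × ZMod M) ⊕ (ZMod M × ZMod M) → (ZMod M × ZMod M) ⊕ (ZMod M × ZMod M) :=
    Sum.map (· + (1, 1)) (· + (1, 1)) with hρ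
  have htile : ∀ f : CARule n, IsTile f T → IsTile f T' → ∀ x, f (S x) (S (r x)) = S (ρ x) := by
    rintro f h h' (g | g)
    exacts [h g, h' g]
  by_cases hlt : stateCount S < (Finset.univ.image fun x => (S x, S (r x))).card
  · refine (ruleProb_mono fun f hf => ?_).trans ((ruleProb_le_of_stateCount_lt ρ
      (NeZero.pos M) (column_periodic T) hn hlt).trans ?_)
    · refine ⟨htile f hf.1.1 hf.2.1, fun c => ?_⟩
      obtain ⟨j, g, hg⟩ := hf.1.2.exists_mem_range c
      exact ⟨j, Sum.inl g, hg⟩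
    · gcongr
      exact le_add_of_nonneg_right hpairs
  by_cases hdisj : ∀ g h, T g ≠ T' h
  · rw [hT.ruleProb_pair_eq (by omega) hT' hdisj, ← one_div_mul_eq_div]
    have hcount : stateCount S ≤ Fintype.card ((ZMod M × ZMod M) ⧸ L) +
        Fintype.card ((ZMod M × ZMod M) ⧸ L') :=
      (stateCount_sum_le T T').trans (add_le_add hT.stateCount_le hT'.stateCount_le)
    refine (mul_le_mul_of_nonneg_left (le_abs_self _) (by positivity)).trans ?_
    refine mul_le_mul (one_div_le_one_div_of_le (pow_pos hn0 _) (pow_le_pow_right₀ hn1 hcount))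
      ((abs_kernelDet_mul_le L L' n).trans (le_add_of_nonneg_left ?_)) (abs_nonneg _)
      (one_div_nonneg.2 (pow_nonneg hn0.le _))
    exact div_nonneg (mul_nonneg (Nat.cast_nonneg _) hrate) hn0.le
  · rw [ruleProb_eq_zero]
    · positivity
    intro f hf
    push Not at hdisj
    obtain ⟨g, h, hgh⟩ := hdisj
    have hstep := fun x y => neighbors_of_card_pairs_le (x := x) (y := y)
      (htile f hf.1.1 hf.2.1) (not_lt.1 hlt)
    have key : ∀ {g h}, T g = T' h → ∀ u, T (g + u) = T' (h + u) :=
      fun hgh => propagate (R := fun g h => T g = T' h)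
        (fun g h => hstep (Sum.inl g) (Sum.inr h)) hgh
    have h1 := key hgh (-g)
    have h2 := key hgh (-h)
    rw [add_neg_cancel] at h1 h2
    have h0 : T 0 = T' 0 := le_antisymm ((hmin _).trans_eq h2) ((hmin' _).trans_eq h1.symm)
    refine hne (funext fun u => ?_)
    simpa using key h0 u

end Estimates

end WRPS

namespace WRPS

section Asymptotics

variable {n M : ℕ}

lemma IsTile.translate {f : CARule n} {T : ZMod M × ZMod M → Fin n} (h : IsTile f T)
    (u : ZMod M × ZMod M) : IsTile f fun g => T (u + g) := fun g => by
  simpa only [add_assoc] using h (u + g)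

lemma ColumnsDecide.translate {f : CARule n} {T : ZMod M × ZMod M → Fin n}
    (h : ColumnsDecide f T) (u : ZMod M × ZMod M) : ColumnsDecide f fun g => T (u + g) :=
  fun g c => by simpa only [add_assoc] using h (u + g) c

variable [NeZero M] (𝒯 𝒮 : Finset ℕ)

open Classical in
/-- The normalized arrays that have a kernel and whose periods are admissible. -/
noncomputable def simpleArrays (M : ℕ) [NeZero M] (n : ℕ) : Finset (ZMod M × ZMod M → Fin n) :=
  (Finset.univ.filter fun L : AddSubgroup (ZMod M × ZMod M) => LatticePeriods 𝒯 𝒮 L).biUnion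
    fun L => normalizedArrays L n

variable {𝒯 𝒮} in
lemma mem_simpleArrays {T : ZMod M × ZMod M → Fin n} :
    T ∈ simpleArrays 𝒯 𝒮 M n ↔
      ∃ L : AddSubgroup (ZMod M × ZMod M), LatticePeriods 𝒯 𝒮 L ∧ T ∈ normalizedArrays L n := by
  simp [simpleArrays]

lemma exists_tendsto_mul_sum_simpleArrays (M : ℕ) [NeZero M] :
    ∃ c, Tendsto (fun n : ℕ => (n : ℝ) * ∑ T ∈ simpleArrays 𝒯 𝒮 M n,
      ruleProb (fun f => IsTile f T ∧ ColumnsDecide f T)) atTop (nhds c) := by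
  classical
  choose c hc using fun L : AddSubgroup (ZMod M × ZMod M) =>
    exists_tendsto_mul_sum_normalizedArrays L
  refine ⟨_, (tendsto_finsetSum (Finset.univ.filter fun L : AddSubgroup (ZMod M × ZMod M) =>
    LatticePeriods 𝒯 𝒮 L) fun L _ => hc L).congr fun n => ?_⟩
  rw [← Finset.mul_sum, simpleArrays, Finset.sum_biUnion]
  intro L _ L' _ hne
  refine Finset.disjoint_left.2 fun T hT hT' => hne ?_
  exact (mem_normalizedArrays.1 hT).1.unique (mem_normalizedArrays.1 hT').1

lemma exists_mem_simpleArrays {f : CARule n} {T : ZMod M × ZMod M → Fin n}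
    (hper : HasPeriodsIn 𝒯 𝒮 T) (hf : IsTile f T ∧ ColumnsDecide f T)
    (hT : ∃ L, HasKernel T L) :
    ∃ T' ∈ simpleArrays 𝒯 𝒮 M n, IsTile f T' ∧ ColumnsDecide f T' := by
  obtain ⟨L, hL⟩ := hT
  obtain ⟨u, hu⟩ := Finite.exists_min T
  refine ⟨fun g => T (u + g), mem_simpleArrays.2 ⟨L, hL.hasPeriodsIn_iff.1 hper,
    mem_normalizedArrays.2 ⟨hL.translate u, fun g => ?_⟩⟩, hf.1.translate u, hf.2.translate u⟩
  rw [add_zero]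
  exact hu _

open Classical in
lemma sum_not_hasKernel_le (hn : Fintype.card (ZMod M × ZMod M) < n) :
    ∑ T ∈ Finset.univ.filter (fun T : ZMod M × ZMod M → Fin n => ¬ ∃ L, HasKernel T L),
      ruleProb (fun f => IsTile f T ∧ ColumnsDecide f T) ≤
    Nat.card (Setoid (ZMod M × ZMod M)) *
      (Fintype.card (ZMod M × ZMod M) * decisionRate M n / n) := by
  have hrate : 0 ≤ decisionRate M n := by unfold decisionRate; positivity
  refine (Finset.sum_le_sum fun T hT =>
    ruleProb_le_of_not_hasKernel hn (Finset.mem_filter.1 hT).2).trans ?_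
  rw [← Finset.sum_mul]
  refine mul_le_mul_of_nonneg_right ?_ (by positivity)
  exact (Finset.sum_le_sum_of_subset_of_nonneg (Finset.filter_subset _ _)
    fun T _ _ => by positivity).trans (sum_stateCount_le (by omega))

open Classical in
lemma sum_offDiag_simpleArrays_le
    (hn : Fintype.card ((ZMod M × ZMod M) ⊕ (ZMod M × ZMod M)) < n) :
    ∑ p ∈ (simpleArrays 𝒯 𝒮 M n).offDiag, ruleProb (fun f =>
      (IsTile f p.1 ∧ ColumnsDecide f p.1) ∧ IsTile f p.2 ∧ ColumnsDecide f p.2) ≤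
    Nat.card (Setoid ((ZMod M × ZMod M) ⊕ (ZMod M × ZMod M))) *
      (Fintype.card ((ZMod M × ZMod M) ⊕ (ZMod M × ZMod M)) * decisionRate M n / n +
        drainPairs M n) := by
  have hrate : 0 ≤ decisionRate M n := by unfold decisionRate; positivity
  have hpairs := drainPairs_nonneg (M := M) n
  refine (Finset.sum_le_sum fun p hp => ?_).trans ((Finset.sum_mul (simpleArrays 𝒯 𝒮 M n).offDiag
    (fun p => 1 / (n : ℝ) ^ stateCount (Sum.elim p.1 p.2)) _).symm.trans_le
    (mul_le_mul_of_nonneg_right ?_ ?_))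
  · obtain ⟨h1, h2, hne⟩ := Finset.mem_offDiag.1 hp
    obtain ⟨L, -, hL⟩ := mem_simpleArrays.1 h1
    obtain ⟨L', -, hL'⟩ := mem_simpleArrays.1 h2
    exact ruleProb_pair_le hn hL hL' hne
  · refine (Finset.sum_le_sum_of_subset_of_nonneg (Finset.subset_univ _)
      fun T _ _ => by positivity).trans ?_
    have h := Equiv.sum_comp (Equiv.sumArrowEquivProdArrow (ZMod M × ZMod M) (ZMod M × ZMod M)
      (Fin n)).symm fun S => 1 / (n : ℝ) ^ stateCount S
    exact h.trans_le (sum_stateCount_le (by omega))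
  · positivity

/-- The probability of a deciding array with admissible periods is asymptotic to `c / n`. -/
lemma exists_tendsto_mul_ruleProb (M : ℕ) [NeZero M] :
    ∃ c, Tendsto (fun n : ℕ => (n : ℝ) * ruleProb (n := n) fun f =>
      ∃ T : ZMod M × ZMod M → Fin n, HasPeriodsIn 𝒯 𝒮 T ∧ IsTile f T ∧ ColumnsDecide f T)
      atTop (nhds c) := by
  classical
  obtain ⟨c, hc⟩ := exists_tendsto_mul_sum_simpleArrays 𝒯 𝒮 M
  let N := Fintype.card (ZMod M × ZMod M)
  let N' := Fintype.card ((ZMod M × ZMod M) ⊕ (ZMod M × ZMod M))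
  let K := (Nat.card (Setoid (ZMod M × ZMod M)) : ℝ)
  let K' := (Nat.card (Setoid ((ZMod M × ZMod M) ⊕ (ZMod M × ZMod M))) : ℝ)
  have hlow : Tendsto (fun n : ℕ => K' * (N' * decisionRate M n + n * drainPairs M n))
      atTop (nhds 0) := by
    simpa using (((tendsto_decisionRate M).const_mul (N' : ℝ)).add
      (tendsto_mul_drainPairs (M := M))).const_mul K'
  have hupp : Tendsto (fun n : ℕ => K * (N * decisionRate M n)) atTop (nhds 0) := by
    simpa using ((tendsto_decisionRate M).const_mul (N : ℝ)).const_mul K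
  refine ⟨c, tendsto_of_tendsto_of_tendsto_of_le_of_le' (by simpa using hc.sub hlow)
    (by simpa using hc.add hupp) ?_ ?_⟩
  · filter_upwards [eventually_gt_atTop N'] with n hn
    have hn0 : (0 : ℝ) < n := by exact_mod_cast (show 0 < n by omega)
    have h1 := sum_sub_sum_offDiag_le (simpleArrays 𝒯 𝒮 M n) fun T f =>
      IsTile f T ∧ ColumnsDecide f T
    have h2 := sum_offDiag_simpleArrays_le 𝒯 𝒮 hn
    have h3 : ruleProb (fun f => ∃ T ∈ simpleArrays 𝒯 𝒮 M n, IsTile f T ∧ ColumnsDecide f T) ≤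
        ruleProb fun f => ∃ T : ZMod M × ZMod M → Fin n,
          HasPeriodsIn 𝒯 𝒮 T ∧ IsTile f T ∧ ColumnsDecide f T := by
      refine ruleProb_mono fun f => ?_
      rintro ⟨T, hT, hf⟩
      obtain ⟨L, hper, hL⟩ := mem_simpleArrays.1 hT
      exact ⟨T, (mem_normalizedArrays.1 hL).1.hasPeriodsIn_iff.2 hper, hf⟩
    have h4 := mul_le_mul_of_nonneg_left
      ((sub_le_sub_left h2 _).trans (h1.trans h3)) hn0.le
    refine le_of_eq_of_le ?_ h4
    simp only [K', N']
    field_simp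
  · filter_upwards [eventually_gt_atTop N] with n hn
    have hn0 : (0 : ℝ) < n := by exact_mod_cast (show 0 < n by omega)
    have h1 : ruleProb (fun f => ∃ T : ZMod M × ZMod M → Fin n,
          HasPeriodsIn 𝒯 𝒮 T ∧ IsTile f T ∧ ColumnsDecide f T) ≤
        ruleProb fun f => (∃ T ∈ simpleArrays 𝒯 𝒮 M n, IsTile f T ∧ ColumnsDecide f T) ∨
          ∃ T ∈ Finset.univ.filter
            (fun T : ZMod M × ZMod M → Fin n => ¬ ∃ L, HasKernel T L),
            IsTile f T ∧ ColumnsDecide f T := by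
      refine ruleProb_mono fun f => ?_
      rintro ⟨T, hper, hf⟩
      by_cases hT : ∃ L, HasKernel T L
      · exact Or.inl (exists_mem_simpleArrays 𝒯 𝒮 hper hf hT)
      · exact Or.inr ⟨T, Finset.mem_filter.2 ⟨Finset.mem_univ _, hT⟩, hf⟩
    have h2 := h1.trans ((ruleProb_or_le _ _).trans (add_le_add (ruleProb_exists_le _ _)
      ((ruleProb_exists_le _ _).trans (sum_not_hasKernel_le hn))))
    refine (mul_le_mul_of_nonneg_left h2 hn0.le).trans_eq ?_
    simp only [K, N]
    field_simp

end Asymptotics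

end WRPS

/-- for a uniformly random `n`-state rule, the probability that
there exists a weakly robust periodic solution with periods `(τ, σ) ∈ 𝒯 × 𝒮`
is `c(𝒯, 𝒮)/n + o(1/n)`, provided some `(τ, σ) ∈ 𝒯 × 𝒮` satisfies `σ ∣ τ`. -/
theorem wrps_probability_asymptotics (𝒯 𝒮 : Finset ℕ)
    (hdiv : ∃ τ ∈ 𝒯, ∃ σ ∈ 𝒮, σ ∣ τ) :
    ∃ c : ℝ, Filter.Tendsto
      (fun n : ℕ => (n : ℝ) *
        ((Nat.card {f : CARule n // ∃ (ξ : ℤ → Fin n) (τ σ : ℕ), τ ∈ 𝒯 ∧ σ ∈ 𝒮 ∧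
            IsPS f ξ τ σ ∧ IsWeaklyRobust f ξ} : ℝ) / (n : ℝ) ^ (n ^ 2)))
      Filter.atTop (nhds c) := by
  classical
  set M := ∏ m ∈ (𝒯 ∪ 𝒮).filter (0 < ·), m with hM
  have hpos : 0 < M := Finset.prod_pos fun m hm => (Finset.mem_filter.1 hm).2
  have : NeZero M := ⟨hpos.ne'⟩
  have hdvd : ∀ m ∈ 𝒯 ∪ 𝒮, 0 < m → m ∣ M := fun m hm h =>
    Finset.dvd_prod_of_mem _ (Finset.mem_filter.2 ⟨hm, h⟩)
  obtain ⟨c, hc⟩ := WRPS.exists_tendsto_mul_ruleProb 𝒯 𝒮 M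
  refine ⟨c, hc.congr fun n => ?_⟩
  simp only [WRPS.ruleProb, WRPS.exists_wrps_iff (M := M)
    (fun τ h => hdvd τ (Finset.mem_union_left _ h))
    (fun σ h => hdvd σ (Finset.mem_union_right _ h))]
end

section
/- Fix τ, σ ≥ 1 and n, let d be a divisor of gcd(τ, σ), and let s = τσ/d with s ≤ n. The number of simple tiles of periodic solutions with temporal period τ, spatial period σ, and exactly s distinct states over the alphabet ℤ_n, counted up to identification of tiles that are obtained from each other by cyclic shifts of the row indices and/or of the column indices, equals φ(d) · C(n, s) · (s − 1)!, where φ is the Euler totient function and C(n, s) the binomial coefficient. -/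
open Filter

section TileLemmas

variable {n τ σ : ℕ} {T : ℕ → ℕ → Fin n}

theorem IsTilePeriodic.apply_mod (hT : IsTilePeriodic τ σ T) (i j : ℕ) :
    T (i % τ) (j % σ) = T i j := by
  have h₁ : Function.Periodic (fun i => T i (j % σ)) τ := fun i => hT.1 i _
  have h₂ : Function.Periodic (T i) σ := fun j => hT.2 i j
  exact (h₁.map_mod_nat i).trans (h₂.map_mod_nat j)

theorem IsTilePeriodic.apply_eq_of_natCast_eq (hT : IsTilePeriodic τ σ T) {i j k m : ℕ}
    (hi : (i : ZMod τ) = k) (hj : (j : ZMod σ) = m) : T i j = T k m := by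
  rw [← hT.apply_mod i j, ← hT.apply_mod k m, (ZMod.natCast_eq_natCast_iff' _ _ _).1 hi,
    (ZMod.natCast_eq_natCast_iff' _ _ _).1 hj]

theorem IsTilePeriodic.mem_tileStates (hT : IsTilePeriodic τ σ T) (hτ : 0 < τ) (hσ : 0 < σ)
    (i j : ℕ) : T i j ∈ tileStates n τ σ T :=
  Finset.mem_image.2 ⟨(i % τ, j % σ), by simp [Nat.mod_lt, hτ, hσ], hT.apply_mod i j⟩

theorem IsTilePeriodic.mem_tilePairs (hT : IsTilePeriodic τ σ T) (hτ : 0 < τ) (hσ : 0 < σ)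
    (i j : ℕ) : (T i j, T i (j + 1)) ∈ tilePairs n τ σ T := by
  refine Finset.mem_image.2 ⟨(i % τ, j % σ), by simp [Nat.mod_lt, hτ, hσ], ?_⟩
  exact Prod.ext (hT.apply_mod i j) (hT.apply_eq_of_natCast_eq (by simp) (by simp))

theorem image_fst_tilePairs : (tilePairs n τ σ T).image Prod.fst = tileStates n τ σ T := by
  simp only [tilePairs, tileStates, Finset.image_image]; rfl

/-- A tile is simple iff every state determines its right neighbor. -/
theorem isSimpleTile_iff (hT : IsTilePeriodic τ σ T) (hτ : 0 < τ) (hσ : 0 < σ) :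
    IsSimpleTile n τ σ T ↔
      ∀ i j k m, T i j = T k m → T i (j + 1) = T k (m + 1) := by
  rw [IsSimpleTile, ← image_fst_tilePairs, eq_comm, Finset.card_image_iff]
  constructor
  · intro h i j k m e
    exact congrArg Prod.snd
      (h (hT.mem_tilePairs hτ hσ i j) (hT.mem_tilePairs hτ hσ k m) e)
  · intro h p hp q hq e
    obtain ⟨⟨i, j⟩, -, rfl⟩ := Finset.mem_image.1 hp
    obtain ⟨⟨k, m⟩, -, rfl⟩ := Finset.mem_image.1 hq
    exact Prod.ext e (h i j k m e)

/-- In a simple tile, positions with equal states have equal surroundings. -/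
theorem IsSimpleTile.shift_eq (hs : IsSimpleTile n τ σ T) (hT : IsPSTile n τ σ T)
    (hτ : 0 < τ) (hσ : 0 < σ) {i j k m : ℕ} (e : T i j = T k m) (a b : ℕ) :
    T (i + a) (j + b) = T (k + a) (m + b) := by
  have right := (isSimpleTile_iff hT.1 hτ hσ).1 hs
  have rights : ∀ {i j k m : ℕ}, T i j = T k m → ∀ b, T i (j + b) = T k (m + b) := by
    intro i j k m e b
    induction b with
    | zero => exact e
    | succ b ih => exact right _ _ _ _ ih
  have down : ∀ {i j k m : ℕ}, T i j = T k m → T (i + 1) j = T (k + 1) m := by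
    intro i j k m e
    have h := rights (hT.2.1 _ _ _ _ e (right _ _ _ _ e)) (σ - 1)
    rwa [add_assoc, add_assoc, Nat.add_sub_cancel' hσ, hT.1.2, hT.1.2] at h
  induction a with
  | zero => exact rights e b
  | succ a ih => exact down ih

end TileLemmas

section Counting

/-- The number of classes of an equivalence relation all of whose classes have `s` elements. -/
theorem Nat.card_quot_mul_of_card_class {α : Type*} [Finite α] {r : α → α → Prop}
    (hr : Equivalence r) {s : ℕ} (h : ∀ a, Nat.card {b // r a b} = s) :
    Nat.card (Quot r) * s = Nat.card α := by
  have := Fintype.ofFinite (Quot r)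
  rw [← Nat.card_congr (Equiv.sigmaFiberEquiv (Quot.mk r)), Nat.card_sigma,
    Finset.sum_congr rfl (g := fun _ => s)]
  · simp [Nat.card_eq_fintype_card]
  · rintro ⟨a⟩ -
    rw [← h a]
    refine Nat.card_congr (Equiv.subtypeEquivRight fun b => ?_)
    rw [eq_comm]
    exact hr.quot_mk_eq_iff a b

variable {τ σ d : ℕ}

theorem ZMod.nsmul_div_eq_zero_iff (hτ : 0 < τ) (hd : d ∣ τ) (k : ℕ) :
    k • ((τ / d : ℕ) : ZMod τ) = 0 ↔ d ∣ k := by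
  obtain ⟨c, rfl⟩ := hd
  have hd0 : 0 < d := Nat.pos_of_mul_pos_right hτ
  have hc0 : 0 < c := Nat.pos_of_mul_pos_left hτ
  rw [Nat.mul_div_cancel_left _ hd0, nsmul_eq_mul, ← Nat.cast_mul, ZMod.natCast_eq_zero_iff]
  exact Nat.mul_dvd_mul_iff_right hc0

theorem ZMod.addOrderOf_div (hτ : 0 < τ) (hd : d ∣ τ) :
    addOrderOf ((τ / d : ℕ) : ZMod τ) = d :=
  Nat.dvd_antisymm
    (addOrderOf_dvd_of_nsmul_eq_zero ((ZMod.nsmul_div_eq_zero_iff hτ hd d).2 dvd_rfl))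
    ((ZMod.nsmul_div_eq_zero_iff hτ hd _).1 (addOrderOf_nsmul_eq_zero _))

/-- The cyclic subgroup of periods generated by `(τ / d, y)`. -/
abbrev periodSubgroup (τ σ d : ℕ) (y : ZMod σ) : AddSubgroup (ZMod τ × ZMod σ) :=
  AddSubgroup.zmultiples (((τ / d : ℕ) : ZMod τ), y)

theorem card_periodSubgroup (hτ : 0 < τ) (hd : d ∣ τ) {y : ZMod σ} (hy : addOrderOf y = d) :
    Nat.card (periodSubgroup τ σ d y) = d := by
  rw [Nat.card_zmultiples, Prod.addOrderOf_mk, ZMod.addOrderOf_div hτ hd, hy, Nat.lcm_self]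

theorem fst_eq_zero_iff_snd_eq_zero_of_mem_periodSubgroup (hτ : 0 < τ) (hd : d ∣ τ)
    {y : ZMod σ} (hy : addOrderOf y = d) {g : ZMod τ × ZMod σ}
    (hg : g ∈ periodSubgroup τ σ d y) : g.1 = 0 ↔ g.2 = 0 := by
  obtain ⟨k, rfl⟩ := AddSubgroup.mem_zmultiples_iff.1 hg
  simp only [Prod.smul_mk]
  rw [← addOrderOf_dvd_iff_zsmul_eq_zero, ← addOrderOf_dvd_iff_zsmul_eq_zero,
    ZMod.addOrderOf_div hτ hd, hy]

theorem periodSubgroup_injective (hτ : 0 < τ) (hd : d ∣ τ) {y z : ZMod σ}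
    (hy : addOrderOf y = d) (h : periodSubgroup τ σ d y = periodSubgroup τ σ d z) :
    y = z := by
  have h₁ : (((τ / d : ℕ) : ZMod τ), z) ∈ periodSubgroup τ σ d y :=
    h ▸ AddSubgroup.mem_zmultiples _
  have h₂ := (periodSubgroup τ σ d y).sub_mem (AddSubgroup.mem_zmultiples _) h₁
  have h₃ := (fst_eq_zero_iff_snd_eq_zero_of_mem_periodSubgroup hτ hd hy h₂).1 (by simp)
  exact sub_eq_zero.1 h₃

/-- A subgroup of order `d` meeting both axes trivially is generated by `(τ / d, y)` for
some `y` of order `d`. -/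
theorem exists_eq_periodSubgroup (hτ : 0 < τ) (hσ : 0 < σ) (hd : d ∣ τ)
    (H : AddSubgroup (ZMod τ × ZMod σ)) (hH : Nat.card H = d)
    (h₁ : ∀ a, (a, 0) ∈ H → a = 0) (h₂ : ∀ b, (0, b) ∈ H → b = 0) :
    ∃ y : ZMod σ, addOrderOf y = d ∧ H = periodSubgroup τ σ d y := by
  have : NeZero τ := ⟨hτ.ne'⟩
  have : NeZero σ := ⟨hσ.ne'⟩
  have hd0 : 0 < d := Nat.pos_of_dvd_of_pos hd hτ
  have := Fintype.ofFinite H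
  have inj : Function.Injective fun h : H => h.1.1 := by
    rintro ⟨⟨a, b⟩, h⟩ ⟨⟨a', b'⟩, h'⟩ (rfl : a = a')
    have := h₂ (b - b') (by simpa using H.sub_mem h h')
    simp [sub_eq_zero.1 this]
  have hsub : (Finset.univ.image fun h : H => h.1.1) ⊆
      Finset.univ.filter fun a : ZMod τ => d • a = 0 := by
    intro a ha
    obtain ⟨h, -, rfl⟩ := Finset.mem_image.1 ha
    have h0 : d • h = 0 := by rw [← hH]; exact card_nsmul_eq_zero'
    simpa using congrArg (fun h : H => h.1.1) h0
  have heq := Finset.eq_of_subset_of_card_le hsub (by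
    rw [Finset.card_image_of_injective _ inj, Finset.card_univ, ← Nat.card_eq_fintype_card, hH]
    exact IsAddCyclic.card_nsmul_eq_zero_le hd0)
  have hmem : ((τ / d : ℕ) : ZMod τ) ∈ Finset.univ.image fun h : H => h.1.1 := by
    rw [heq]
    simpa using (ZMod.nsmul_div_eq_zero_iff hτ hd d).2 dvd_rfl
  obtain ⟨⟨⟨a, y⟩, hay⟩, -, rfl : a = _⟩ := Finset.mem_image.1 hmem
  have hy : addOrderOf y = d := by
    refine Nat.dvd_antisymm (addOrderOf_dvd_of_nsmul_eq_zero (h₂ _ ?_)) ?_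
    · simpa only [Prod.smul_mk, (ZMod.nsmul_div_eq_zero_iff hτ hd d).2 dvd_rfl]
        using H.nsmul_mem hay d
    · refine (ZMod.nsmul_div_eq_zero_iff hτ hd _).1 (h₁ _ ?_)
      simpa only [Prod.smul_mk, addOrderOf_nsmul_eq_zero] using H.nsmul_mem hay (addOrderOf y)
  refine ⟨y, hy, (AddSubgroup.eq_of_le_of_card_ge (AddSubgroup.zmultiples_le_of_mem hay) ?_).symm⟩
  rw [card_periodSubgroup hτ hd hy, hH]

theorem card_quotient_periodSubgroup (hτ : 0 < τ) (hd : d ∣ τ)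
    {y : ZMod σ} (hy : addOrderOf y = d) :
    Nat.card ((ZMod τ × ZMod σ) ⧸ periodSubgroup τ σ d y) = τ * σ / d := by
  have h := AddSubgroup.card_eq_card_quotient_mul_card_addSubgroup (periodSubgroup τ σ d y)
  rw [card_periodSubgroup hτ hd hy, Nat.card_prod, Nat.card_zmod, Nat.card_zmod] at h
  rw [h, Nat.mul_div_cancel _ (Nat.pos_of_dvd_of_pos hd hτ)]

variable {n : ℕ}

/-- The simple tiles with `τ * σ / d` states. -/
abbrev SimpleTile (n τ σ d : ℕ) : Type :=
  {T : ℕ → ℕ → Fin n // IsPSTile n τ σ T ∧ IsSimpleTile n τ σ T ∧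
    (tileStates n τ σ T).card = τ * σ / d}

/-- The array that reads off a function on `ZMod τ × ZMod σ`. -/
def unfoldTile {α : Type*} (f : ZMod τ × ZMod σ → α) (i j : ℕ) : α := f (i, j)

theorem isTilePeriodic_unfoldTile (f : ZMod τ × ZMod σ → Fin n) :
    IsTilePeriodic τ σ (unfoldTile f) := by
  constructor <;> intro i j <;> simp [unfoldTile]

theorem tileStates_unfoldTile [NeZero τ] [NeZero σ] (f : ZMod τ × ZMod σ → Fin n) :
    tileStates n τ σ (unfoldTile f) = Finset.univ.image f := by
  ext a
  simp only [Finset.mem_image, Finset.mem_univ, true_and]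
  constructor
  · intro h
    obtain ⟨p, -, rfl⟩ := Finset.mem_image.1 h
    exact ⟨_, rfl⟩
  · rintro ⟨⟨x, y⟩, rfl⟩
    simpa [unfoldTile] using (isTilePeriodic_unfoldTile f).mem_tileStates
      (NeZero.pos τ) (NeZero.pos σ) x.val y.val

theorem unfoldTile_injective [NeZero τ] [NeZero σ] {α : Type*} :
    Function.Injective (unfoldTile (τ := τ) (σ := σ) (α := α)) := by
  intro f g h
  funext ⟨x, y⟩
  simpa [unfoldTile] using congrFun (congrFun h x.val) y.val

theorem IsTilePeriodic.exists_unfoldTile [NeZero τ] [NeZero σ] {T : ℕ → ℕ → Fin n}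
    (hT : IsTilePeriodic τ σ T) : ∃ f : ZMod τ × ZMod σ → Fin n, T = unfoldTile f :=
  ⟨fun g => T g.1.val g.2.val, by
    funext i j
    simp only [unfoldTile, ZMod.val_natCast, hT.apply_mod]⟩

theorem card_image_mk {G : Type*} [AddCommGroup G] [Fintype G] (H : AddSubgroup G)
    (e : (G ⧸ H) ↪ Fin n) :
    (Finset.univ.image fun g : G => e g).card = Nat.card (G ⧸ H) := by
  classical
  have := Fintype.ofFinite (G ⧸ H)
  have h : (Finset.univ.image fun g : G => e g) = Finset.univ.map e := by
    ext a
    simp [(QuotientAddGroup.mk_surjective (s := H)).exists]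
  rw [h, Finset.card_map, Finset.card_univ, Nat.card_eq_fintype_card]

theorem unfoldTile_mem [NeZero τ] [NeZero σ] (hd : d ∣ τ) {y : ZMod σ} (hy : addOrderOf y = d)
    (e : ((ZMod τ × ZMod σ) ⧸ periodSubgroup τ σ d y) ↪ Fin n) :
    IsPSTile n τ σ (unfoldTile fun g : ZMod τ × ZMod σ => e g) ∧
    IsSimpleTile n τ σ (unfoldTile fun g : ZMod τ × ZMod σ => e g) ∧
      (tileStates n τ σ (unfoldTile fun g : ZMod τ × ZMod σ => e g)).card = τ * σ / d := by
  have hτ : 0 < τ := NeZero.pos τ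
  have hσ : 0 < σ := NeZero.pos σ
  have key : ∀ i j k m : ℕ,
      unfoldTile (fun g : ZMod τ × ZMod σ => e g) i j =
          unfoldTile (fun g : ZMod τ × ZMod σ => e g) k m ↔
        (-(i : ZMod τ) + k, -(j : ZMod σ) + m) ∈ periodSubgroup τ σ d y := by
    intro i j k m
    rw [unfoldTile, unfoldTile, e.injective.eq_iff, QuotientAddGroup.eq]
    rfl
  have axes := fun {g} => fst_eq_zero_iff_snd_eq_zero_of_mem_periodSubgroup hτ hd hy (g := g)
  have hper := isTilePeriodic_unfoldTile fun g : ZMod τ × ZMod σ => e g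
  refine ⟨⟨hper, ?_, ?_, ?_⟩, (isSimpleTile_iff hper hτ hσ).2 ?_, ?_⟩
  · intro i j k m h _
    rw [key] at h ⊢
    convert h using 2 <;> push_cast <;> ring
  · intro i p hp h
    have h := (key _ _ _ _).1 (h 0)
    have h0 := (axes h).1 (by simp)
    simp only [Nat.cast_zero, zero_add, add_zero, neg_eq_zero,
      ZMod.natCast_eq_zero_iff] at h0
    exact Nat.le_of_dvd hp h0
  · intro p hp h
    have h := (key _ _ _ _).1 (h 0 0)
    have h0 := (axes h).2 (by simp)
    simp only [Nat.cast_zero, zero_add, add_zero, neg_eq_zero,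
      ZMod.natCast_eq_zero_iff] at h0
    exact Nat.le_of_dvd hp h0
  · intro i j k m h
    rw [key] at h ⊢
    convert h using 2
    push_cast
    ring
  · rw [tileStates_unfoldTile, card_image_mk, card_quotient_periodSubgroup hτ hd hy]

/-- The period lattice of a simple tile and the labelling of its cosets. -/
theorem exists_quotient_embedding [NeZero τ] [NeZero σ] (hd : d ∣ τ) (T : SimpleTile n τ σ d) :
    ∃ y : ZMod σ, addOrderOf y = d ∧
      ∃ e : ((ZMod τ × ZMod σ) ⧸ periodSubgroup τ σ d y) ↪ Fin n,
        T.1 = unfoldTile fun g : ZMod τ × ZMod σ => e g := by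
  have hτ : 0 < τ := NeZero.pos τ
  have hσ : 0 < σ := NeZero.pos σ
  obtain ⟨T, hT, hs, hcard⟩ := T
  obtain ⟨f, rfl⟩ := hT.1.exists_unfoldTile
  have shift : ∀ {g g' : ZMod τ × ZMod σ}, f g = f g' → ∀ h, f (g + h) = f (g' + h) := by
    rintro ⟨i, j⟩ ⟨k, m⟩ e ⟨a, b⟩
    simpa [unfoldTile] using hs.shift_eq hT hτ hσ
      (i := i.val) (j := j.val) (k := k.val) (m := m.val)
      (by simpa [unfoldTile] using e) a.val b.val
  let H : AddSubgroup (ZMod τ × ZMod σ) :=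
    { carrier := {h | f h = f 0}
      zero_mem' := rfl
      add_mem' := fun {a b} ha hb => by
        have := shift (show f a = f 0 from ha) b
        rw [zero_add] at this
        exact this.trans hb
      neg_mem' := fun {a} ha => by
        have := shift (show f a = f 0 from ha) (-a)
        rw [add_neg_cancel, zero_add] at this
        exact this.symm }
  have hH : ∀ g g', f g = f g' ↔ -g + g' ∈ H := by
    intro g g'
    constructor
    · intro e
      have := shift e (-g)
      rw [add_neg_cancel, add_comm] at this
      exact this.symm
    · intro e
      have := shift (show f (-g + g') = f 0 from e) g
      rw [zero_add, add_comm (-g), neg_add_cancel_right] at this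
      exact this.symm
  let e : ((ZMod τ × ZMod σ) ⧸ H) ↪ Fin n :=
    ⟨Quotient.lift f fun a b hab => (hH a b).2 (QuotientAddGroup.leftRel_apply.1 hab), by
      rintro ⟨a⟩ ⟨b⟩ hab
      exact QuotientAddGroup.eq.2 ((hH a b).1 hab)⟩
  have hcardH : Nat.card H = d := by
    have h₁ : Nat.card ((ZMod τ × ZMod σ) ⧸ H) = τ * σ / d := by
      rw [← card_image_mk H e, ← hcard, tileStates_unfoldTile]
      rfl
    have h₂ := AddSubgroup.card_eq_card_quotient_mul_card_addSubgroup H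
    rw [h₁, Nat.card_prod, Nat.card_zmod, Nat.card_zmod] at h₂
    have h₃ : τ * σ / d * d = τ * σ := Nat.div_mul_cancel (hd.mul_right σ)
    have h₄ : 0 < τ * σ / d := Nat.pos_of_mul_pos_right (h₃ ▸ Nat.mul_pos hτ hσ)
    exact Nat.eq_of_mul_eq_mul_left h₄ (h₂.symm.trans h₃.symm)
  have h₁ : ∀ a, (a, 0) ∈ H → a = 0 := by
    intro a ha
    by_contra hne
    refine (ZMod.val_lt a).not_ge (hT.2.2.2 a.val (ZMod.val_pos.2 hne) fun i j => ?_)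
    have := shift (show f (a, 0) = f 0 from ha) (i, j)
    simpa [unfoldTile, add_comm] using this
  have h₂ : ∀ b, (0, b) ∈ H → b = 0 := by
    intro b hb
    by_contra hne
    refine (ZMod.val_lt b).not_ge (hT.2.2.1 0 b.val (ZMod.val_pos.2 hne) fun j => ?_)
    have := shift (show f (0, b) = f 0 from hb) (0, j)
    simpa [unfoldTile, add_comm] using this
  obtain ⟨y, hy, hHy⟩ := exists_eq_periodSubgroup hτ hσ hd H hcardH h₁ h₂
  exact ⟨y, hy, hHy ▸ ⟨e, rfl⟩⟩

/-- The number of simple tiles, without identification. -/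
theorem card_simpleTile [NeZero τ] [NeZero σ] (hdτ : d ∣ τ) (hdσ : d ∣ σ) :
    Finite (SimpleTile n τ σ d) ∧
      Nat.card (SimpleTile n τ σ d) = Nat.totient d * n.descFactorial (τ * σ / d) := by
  have hτ : 0 < τ := NeZero.pos τ
  let F : (Σ y : {y : ZMod σ // addOrderOf y = d},
      ((ZMod τ × ZMod σ) ⧸ periodSubgroup τ σ d y.1) ↪ Fin n) → SimpleTile n τ σ d :=
    fun p => ⟨unfoldTile fun g : ZMod τ × ZMod σ => p.2 g, unfoldTile_mem hdτ p.1.2 p.2⟩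
  have hF : Function.Bijective F := by
    constructor
    · rintro ⟨⟨y, hy⟩, e⟩ ⟨⟨z, hz⟩, e'⟩ h
      have h : (fun g : ZMod τ × ZMod σ => e g) =
          fun g : ZMod τ × ZMod σ => e' g := unfoldTile_injective (Subtype.ext_iff.1 h)
      have hyz : y = z := by
        refine periodSubgroup_injective hτ hdτ hy (AddSubgroup.ext fun g => ?_)
        have := congrFun h 0
        have := congrFun h g
        rw [← QuotientAddGroup.eq_zero_iff, ← QuotientAddGroup.eq_zero_iff,
          ← e.injective.eq_iff, ← e'.injective.eq_iff]
        simp_all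
      subst hyz
      have : e = e' := by
        ext ⟨g⟩
        exact congrArg Fin.val (congrFun h g)
      rw [this]
    · intro T
      obtain ⟨y, hy, e, he⟩ := exists_quotient_embedding hdτ T
      exact ⟨⟨⟨y, hy⟩, e⟩, Subtype.ext he.symm⟩
  refine ⟨Finite.of_surjective F hF.2, ?_⟩
  rw [← Nat.card_congr (Equiv.ofBijective F hF), Nat.card_sigma,
    Finset.sum_congr rfl (g := fun _ => n.descFactorial (τ * σ / d))]
  · rw [Finset.sum_const, smul_eq_mul, Finset.card_univ, Fintype.card_subtype,
      IsAddCyclic.card_addOrderOf_eq_totient (by rwa [ZMod.card])]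
  · rintro ⟨y, hy⟩ -
    have := Fintype.ofFinite ((ZMod τ × ZMod σ) ⧸ periodSubgroup τ σ d y)
    rw [Nat.card_eq_fintype_card, Fintype.card_embedding_eq, Fintype.card_fin,
      ← Nat.card_eq_fintype_card, card_quotient_periodSubgroup hτ hdτ hy]

/-- Two tiles are identified if they differ by cyclic shifts of rows and columns. -/
theorem equivalence_shift (hτ : 0 < τ) (hσ : 0 < σ) :
    Equivalence fun T₁ T₂ : SimpleTile n τ σ d =>
      ∃ r c : ℕ, ∀ i j, T₂.1 i j = T₁.1 (i + r) (j + c) where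
  refl T := ⟨0, 0, fun _ _ => rfl⟩
  symm := by
    rintro T₁ T₂ ⟨r, c, h⟩
    refine ⟨r * τ - r, c * σ - c, fun i j => ?_⟩
    rw [h]
    refine T₁.2.1.1.apply_eq_of_natCast_eq ?_ ?_
    · rw [add_assoc, Nat.sub_add_cancel (Nat.le_mul_of_pos_right r hτ)]
      simp
    · rw [add_assoc, Nat.sub_add_cancel (Nat.le_mul_of_pos_right c hσ)]
      simp
  trans := by
    rintro T₁ T₂ T₃ ⟨r, c, h⟩ ⟨r', c', h'⟩
    exact ⟨r' + r, c' + c, fun i j => by rw [h', h, add_assoc, add_assoc]⟩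

theorem IsPSTile.shift {T : ℕ → ℕ → Fin n} (hT : IsPSTile n τ σ T) (hτ : 0 < τ) (hσ : 0 < σ)
    (r c : ℕ) : IsPSTile n τ σ fun i j => T (i + r) (j + c) := by
  refine ⟨⟨fun i j => ?_, fun i j => ?_⟩, fun i j k m h h' => ?_, fun i p hp h => ?_,
    fun p hp h => ?_⟩
  · dsimp only; rw [add_right_comm]; exact hT.1.1 _ _
  · dsimp only; rw [add_right_comm]; exact hT.1.2 _ _
  · simp only [add_right_comm _ 1] at h' ⊢
    exact hT.2.1 _ _ _ _ h h'
  · refine hT.2.2.1 (i + r) p hp fun j => ?_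
    have := h (j + (c * σ - c))
    dsimp only at this
    have e : j + (c * σ - c) + c = j + c * σ := by
      rw [add_assoc, Nat.sub_add_cancel (Nat.le_mul_of_pos_right c hσ)]
    rw [add_right_comm, e] at this
    refine (hT.1.apply_eq_of_natCast_eq rfl ?_).trans
      (this.trans (hT.1.apply_eq_of_natCast_eq rfl ?_)) <;> simp
  · refine hT.2.2.2 p hp fun i j => ?_
    have := h (i + (r * τ - r)) (j + (c * σ - c))
    dsimp only at this
    have e : j + (c * σ - c) + c = j + c * σ := by
      rw [add_assoc, Nat.sub_add_cancel (Nat.le_mul_of_pos_right c hσ)]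
    have e' : i + (r * τ - r) + r = i + r * τ := by
      rw [add_assoc, Nat.sub_add_cancel (Nat.le_mul_of_pos_right r hτ)]
    rw [add_right_comm _ p, e, e'] at this
    refine (hT.1.apply_eq_of_natCast_eq ?_ ?_).trans
      (this.trans (hT.1.apply_eq_of_natCast_eq ?_ ?_)) <;> simp

theorem tileStates_shift {T : ℕ → ℕ → Fin n} (hT : IsPSTile n τ σ T) (hτ : 0 < τ)
    (hσ : 0 < σ) (r c : ℕ) :
    tileStates n τ σ (fun i j => T (i + r) (j + c)) = tileStates n τ σ T := by
  ext a
  constructor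
  · intro h
    obtain ⟨p, -, rfl⟩ := Finset.mem_image.1 h
    exact hT.1.mem_tileStates hτ hσ _ _
  · intro h
    obtain ⟨⟨i, j⟩, -, rfl⟩ := Finset.mem_image.1 h
    have := (hT.shift hτ hσ r c).1.mem_tileStates hτ hσ (i + (r * τ - r)) (j + (c * σ - c))
    rw [add_assoc, Nat.sub_add_cancel (Nat.le_mul_of_pos_right r hτ), add_assoc,
      Nat.sub_add_cancel (Nat.le_mul_of_pos_right c hσ)] at this
    rwa [hT.1.apply_eq_of_natCast_eq (k := i) (m := j) (by simp) (by simp)] at this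

/-- Reading off the corner state identifies the shifts of a tile with its states. -/
theorem card_shift_class (hτ : 0 < τ) (hσ : 0 < σ) (T : SimpleTile n τ σ d) :
    Nat.card {T' : SimpleTile n τ σ d //
      ∃ r c : ℕ, ∀ i j, T'.1 i j = T.1 (i + r) (j + c)} = τ * σ / d := by
  obtain ⟨T, hT, hs, hcard⟩ := T
  refine Eq.trans ?_ ((Nat.card_eq_fintype_card.trans (Fintype.card_coe _)).trans hcard)
  refine Nat.card_congr (Equiv.ofBijective
    (fun T' => ⟨T'.1.1 0 0, by
      obtain ⟨T', r, c, h⟩ := T'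
      rw [h]
      exact hT.1.mem_tileStates hτ hσ _ _⟩) ⟨?_, ?_⟩)
  · rintro ⟨T₁, r, c, h⟩ ⟨T₂, r', c', h'⟩ e
    have e : T₁.1 0 0 = T₂.1 0 0 := congrArg Subtype.val e
    refine Subtype.ext (Subtype.ext (funext fun i => funext fun j => ?_))
    rw [h, h'] at e ⊢
    have := hs.shift_eq hT hτ hσ e i j
    simpa [add_comm] using this
  · rintro ⟨a, ha⟩
    obtain ⟨⟨r, c⟩, -, rfl⟩ := Finset.mem_image.1 ha
    have hps := hT.shift hτ hσ r c
    refine ⟨⟨⟨fun i j => T (i + r) (j + c), hps, (isSimpleTile_iff hps.1 hτ hσ).2 ?_, ?_⟩,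
      r, c, fun i j => rfl⟩, by simp⟩
    · intro i j k m e
      simpa only [add_right_comm _ 1, add_zero] using hs.shift_eq hT hτ hσ e 0 1
    · rw [tileStates_shift hT hτ hσ, hcard]

end Counting

/-- the number of simple tiles of periodic solutions with periods
`τ, σ` and exactly `s = τσ/d` distinct states over `ℤ_n`, counted up to cyclic
shifts of the row and column indices, equals `φ(d)·C(n,s)·(s−1)!`. -/
theorem simple_tile_count (n τ σ d : ℕ) (hτ : 1 ≤ τ) (hσ : 1 ≤ σ)
    (hd : d ∣ Nat.gcd τ σ) (hs : τ * σ / d ≤ n) :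
    Nat.card (Quot (fun T₁ T₂ :
        {T : ℕ → ℕ → Fin n // IsPSTile n τ σ T ∧ IsSimpleTile n τ σ T ∧
          (tileStates n τ σ T).card = τ * σ / d} =>
        ∃ r c : ℕ, ∀ i j, T₂.1 i j = T₁.1 (i + r) (j + c)))
      = Nat.totient d * Nat.choose n (τ * σ / d) * Nat.factorial (τ * σ / d - 1) := by
  have : NeZero τ := ⟨by omega⟩
  have : NeZero σ := ⟨by omega⟩
  have hdτ : d ∣ τ := hd.trans (Nat.gcd_dvd_left _ _)
  obtain ⟨hfin, hcard⟩ := card_simpleTile (n := n) hdτ (hd.trans (Nat.gcd_dvd_right _ _))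
  have h := Nat.card_quot_mul_of_card_class (equivalence_shift (n := n) (d := d) hτ hσ)
    (card_shift_class hτ hσ)
  have hpos : 0 < τ * σ / d :=
    Nat.div_pos (Nat.le_of_dvd (Nat.mul_pos hτ hσ) (hdτ.mul_right σ))
      (Nat.pos_of_dvd_of_pos hdτ hτ)
  refine Nat.eq_of_mul_eq_mul_right hpos (h.trans ?_)
  rw [hcard, Nat.descFactorial_eq_factorial_mul_choose, ← Nat.mul_factorial_pred hpos.ne']
  ring
end

section
/- Fix τ ≥ 1 and fix two labels A = a_0…a_{τ−1} and B = b_0…b_{τ−1} with entries in {0,…,τ−1} (not necessarily simple), viewed as labels over ℤ_n for every n ≥ τ. Assume the pair (A, B) is consistent, i.e., whenever (a_i, b_i) = (a_k, b_k) one has b_{(i+1) mod τ} = b_{(k+1) mod τ} (so that the event A → B has positive probability for every n). Then, for a uniformly random n-state 2-neighbor rule f, the conditional probability P(A ⇒ B | A → B) = #{f : A ⇒_f B}/#{f : A →_f B} tends to 0 as n → ∞. -/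
open Filter

open Classical in
/-- The rule `f` with its value at `(x, y)` replaced by `v`. -/
noncomputable def CARule.modify {n : ℕ} (f : CARule n) (x y v : Fin n) : CARule n :=
  fun a b => if a = x ∧ b = y then v else f a b

/-- The sequence chased from `d` enters `S` for the first time at step `T`. -/
def IsFirstHit {n : ℕ} (f : CARule n) (A : ℕ → Fin n) (d : Fin n) (S : Finset (Fin n))
    (T : ℕ) : Prop :=
  chaseSeq f A d T ∈ S ∧ ∀ j < T, chaseSeq f A d j ∉ S

section FirstHit

variable {n : ℕ} {f g : CARule n} {A B : ℕ → Fin n} {d : Fin n} {S : Finset (Fin n)}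

theorem CARule.modify_self (f : CARule n) (x y v : Fin n) : f.modify x y v x y = v := by
  simp [CARule.modify]

theorem CARule.eq_of_modify_eq {x y v : Fin n} (h : f.modify x y v = g.modify x y v)
    (hxy : f x y = g x y) : f = g := by
  funext a b
  have hab := congrFun (congrFun h a) b
  by_cases hc : a = x ∧ b = y
  · rw [hc.1, hc.2, hxy]
  · simpa [CARule.modify, hc] using hab

theorem RightExtends.modify (hf : RightExtends f A B) (hB : ∀ i, B i ∈ S) {x y v : Fin n}
    (hy : y ∉ S) : RightExtends (f.modify x y v) A B := by
  intro i
  have : ¬ (A i = x ∧ B i = y) := fun h => hy (h.2 ▸ hB i)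
  simpa [CARule.modify, this] using hf i

theorem chaseSeq_modify {x y v : Fin n} {T : ℕ}
    (h : ∀ j < T, ¬ (A j = x ∧ chaseSeq f A d j = y)) :
    ∀ j ≤ T, chaseSeq (f.modify x y v) A d j = chaseSeq f A d j
  | 0, _ => rfl
  | j + 1, hj => by
    have ih := chaseSeq_modify (v := v) h j (by omega)
    simp [chaseSeq, ih, CARule.modify, h j (by omega)]

theorem chaseSeq_add_congr {τ r i : ℕ} (hA : ∀ i, A (i + τ) = A i)
    (h : chaseSeq f A d (i + r * τ) = chaseSeq f A d i) (s : ℕ) :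
    chaseSeq f A d (i + r * τ + s) = chaseSeq f A d (i + s) := by
  have hper : ∀ j, A (j + r * τ) = A j := fun j => (show Function.Periodic A τ from hA).nat_mul r j
  induction s with
  | zero => exact h
  | succ s ih =>
    have := hper (i + s)
    rw [show i + s + r * τ = i + r * τ + s by ring] at this
    rw [← add_assoc, ← add_assoc, chaseSeq, chaseSeq, ih, this]

namespace IsFirstHit

theorem fresh {T : ℕ} (h : IsFirstHit f A d S (T + 1)) :
    ∀ j < T, ¬ (A j = A T ∧ chaseSeq f A d j = chaseSeq f A d T) := by
  rintro j hj ⟨h₁, h₂⟩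
  refine h.2 (j + 1) (by omega) ?_
  have := h.1
  rwa [chaseSeq, ← h₁, ← h₂] at this

theorem ne_of_modEq {τ r i T : ℕ} (hτ : 0 < τ) (hA : ∀ i, A (i + τ) = A i)
    (h : IsFirstHit f A d S T) (hr : 0 < r) (hi : i + r * τ ≤ T) :
    chaseSeq f A d (i + r * τ) ≠ chaseSeq f A d i := by
  intro heq
  have hpos : 0 < r * τ := Nat.mul_pos hr hτ
  refine h.2 (i + (T - (i + r * τ))) (by omega) ?_
  rw [← chaseSeq_add_congr hA heq, Nat.add_sub_cancel' hi]
  exact h.1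

theorem eq_of_sub_mul_eq {τ r s T : ℕ} (hτ : 0 < τ) (hA : ∀ i, A (i + τ) = A i)
    (h : IsFirstHit f A d S T) (hr : r * τ ≤ T) (hs : s * τ ≤ T)
    (heq : chaseSeq f A d (T - r * τ) = chaseSeq f A d (T - s * τ)) : r = s := by
  wlog hrs : r ≤ s generalizing r s
  · exact (this hs hr heq.symm (by omega)).symm
  by_contra hne
  obtain ⟨t, rfl⟩ := Nat.exists_eq_add_of_le hrs
  have hmul : (r + t) * τ = r * τ + t * τ := by ring
  refine h.ne_of_modEq (i := T - (r + t) * τ) (r := t) hτ hA (by omega) (by omega) ?_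
  rw [← heq]
  congr 1
  omega

theorem chaseSeq_modify {T : ℕ} (h : IsFirstHit f A d S (T + 1)) (v : Fin n) :
    ∀ j ≤ T, chaseSeq (f.modify (A T) (chaseSeq f A d T) v) A d j = chaseSeq f A d j :=
  _root_.chaseSeq_modify h.fresh

/-- Redirecting the step into `S` loses only the point at which `S` was entered, once the
time of entry is known. -/
theorem eq_of_modify_eq {T : ℕ} {v w : Fin n} (hf : IsFirstHit f A d S (T + 1))
    (hg : IsFirstHit g A d S (T + 1))
    (hs : chaseSeq f A d (T + 1) = chaseSeq g A d (T + 1))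
    (h : f.modify (A T) (chaseSeq f A d T) v = g.modify (A T) (chaseSeq g A d T) w) :
    f = g ∧ v = w := by
  have hc : chaseSeq f A d T = chaseSeq g A d T := by
    rw [← hf.chaseSeq_modify v T le_rfl, h, hg.chaseSeq_modify w T le_rfl]
  have hvw : v = w := by
    rw [← f.modify_self (A T) (chaseSeq f A d T) v, h, hc, CARule.modify_self]
  rw [chaseSeq, chaseSeq, ← hc] at hs
  rw [← hc, ← hvw] at h
  exact ⟨CARule.eq_of_modify_eq h hs, hvw⟩

/-- Redirecting the step into `S` to an earlier point of the same phase closes a cycle, from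
which the time of entry can be read off. -/
theorem le_of_modify_eq {τ r s T U : ℕ} (hτ : 0 < τ) (hA : ∀ i, A (i + τ) = A i)
    (hf : IsFirstHit f A d S (T + 1)) (hg : IsFirstHit g A d S (U + 1)) (hr : 0 < r)
    (hrT : r * τ ≤ T + 1)
    (h : f.modify (A T) (chaseSeq f A d T) (chaseSeq f A d (T + 1 - r * τ)) =
      g.modify (A U) (chaseSeq g A d U) (chaseSeq g A d (U + 1 - s * τ))) : U ≤ T := by
  by_contra! hlt
  have hpos : 0 < r * τ := Nat.mul_pos hr hτ
  set k := f.modify (A T) (chaseSeq f A d T) (chaseSeq f A d (T + 1 - r * τ)) with hk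
  have hkf : ∀ j ≤ T, chaseSeq k A d j = chaseSeq f A d j := hf.chaseSeq_modify _
  have hkg : ∀ j ≤ U, chaseSeq k A d j = chaseSeq g A d j := by
    rw [h]; exact hg.chaseSeq_modify _
  have hrep : chaseSeq k A d (T + 1) = chaseSeq k A d (T + 1 - r * τ) := by
    rw [chaseSeq, hkf T le_rfl, hkf _ (by omega), hk, CARule.modify_self]
  refine hg.ne_of_modEq (i := T + 1 - r * τ) (r := r) hτ hA hr (by omega) ?_
  rw [Nat.sub_add_cancel hrT, ← hkg _ (by omega), ← hkg _ (by omega), hrep]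

end IsFirstHit

theorem exists_isFirstHit {j : ℕ} (h : chaseSeq f A d j ∈ S) : ∃ T, IsFirstHit f A d S T := by
  classical
  have hex : ∃ j, chaseSeq f A d j ∈ S := ⟨j, h⟩
  exact ⟨Nat.find hex, Nat.find_spec hex, fun _ hj => Nat.find_min hex hj⟩

open Classical in
theorem card_isFirstHit_mul_le (hB : ∀ i, B i ∈ S) (T : ℕ) :
    (Finset.univ.filter fun f : CARule n =>
        RightExtends f A B ∧ IsFirstHit f A d S (T + 1)).card * n ≤
      S.card * (Finset.univ.filter fun f : CARule n => RightExtends f A B).card := by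
  conv_lhs => arg 2; rw [← Finset.card_fin n]
  rw [← Finset.card_product, ← Finset.card_product]
  refine Finset.card_le_card_of_injOn (fun p => (chaseSeq p.1 A d (T + 1),
    p.1.modify (A T) (chaseSeq p.1 A d T) p.2)) ?_ ?_
  · rintro ⟨f, v⟩ hp
    simp only [Finset.coe_product, Set.mem_prod, Finset.mem_coe, Finset.mem_filter,
      Finset.mem_univ, true_and, and_true] at hp ⊢
    exact ⟨hp.2.1, hp.1.modify hB (hp.2.2 T (by omega))⟩
  · rintro ⟨f, v⟩ hf ⟨g, w⟩ hg heq
    simp only [Finset.coe_product, Set.mem_prod, Finset.mem_coe, Finset.mem_filter,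
      Finset.mem_univ, true_and, and_true] at hf hg
    simp only [Prod.mk.injEq] at heq ⊢
    exact hf.2.eq_of_modify_eq hg.2 heq.1 heq.2

open Classical in
theorem card_late_isFirstHit_mul_le {τ : ℕ} (hτ : 0 < τ) (hA : ∀ i, A (i + τ) = A i)
    (hB : ∀ i, B i ∈ S) (K : ℕ) :
    (Finset.univ.filter fun f : CARule n =>
        RightExtends f A B ∧ ∃ T, K * τ ≤ T + 1 ∧ IsFirstHit f A d S (T + 1)).card * K ≤
      S.card * (Finset.univ.filter fun f : CARule n => RightExtends f A B).card := by
  have hKcard : (Finset.Icc 1 K).card = K := by simp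
  conv_lhs => arg 2; rw [← hKcard]
  rw [← Finset.card_product, ← Finset.card_product]
  have hT : ∀ f : CARule n, ∃ T,
      (∃ T, K * τ ≤ T + 1 ∧ IsFirstHit f A d S (T + 1)) →
        K * τ ≤ T + 1 ∧ IsFirstHit f A d S (T + 1) := by
    intro f
    by_cases h : ∃ T, K * τ ≤ T + 1 ∧ IsFirstHit f A d S (T + 1)
    · obtain ⟨T, hT⟩ := h
      exact ⟨T, fun _ => hT⟩
    · exact ⟨0, fun h' => absurd h' h⟩
  choose T hT using hT
  refine Finset.card_le_card_of_injOn (fun p => (chaseSeq p.1 A d (T p.1 + 1),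
    p.1.modify (A (T p.1)) (chaseSeq p.1 A d (T p.1))
      (chaseSeq p.1 A d (T p.1 + 1 - p.2 * τ)))) ?_ ?_
  · rintro ⟨f, r⟩ hp
    simp only [Finset.coe_product, Set.mem_prod, Finset.mem_coe, Finset.mem_filter,
      Finset.mem_univ, true_and, Finset.mem_Icc] at hp ⊢
    have hf := (hT f hp.1.2).2
    exact ⟨hf.1, hp.1.1.modify hB (hf.2 _ (by omega))⟩
  · rintro ⟨f, r⟩ hf ⟨g, s⟩ hg heq
    simp only [Finset.coe_product, Set.mem_prod, Finset.mem_coe, Finset.mem_filter,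
      Finset.mem_univ, true_and, Finset.mem_Icc] at hf hg
    simp only [Prod.mk.injEq] at heq ⊢
    obtain ⟨hKf, hf'⟩ := hT f hf.1.2
    obtain ⟨hKg, hg'⟩ := hT g hg.1.2
    have hrT : r * τ ≤ T f + 1 := (Nat.mul_le_mul_right τ hf.2.2).trans hKf
    have hsT : s * τ ≤ T g + 1 := (Nat.mul_le_mul_right τ hg.2.2).trans hKg
    have hTT : T g = T f := le_antisymm
      (hf'.le_of_modify_eq hτ hA hg' hf.2.1 hrT heq.2)
      (hg'.le_of_modify_eq hτ hA hf' hg.2.1 hsT heq.2.symm)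
    rw [hTT] at heq hg' hsT
    obtain ⟨rfl, hv⟩ := hf'.eq_of_modify_eq hg' heq.1 heq.2
    exact ⟨rfl, hf'.eq_of_sub_mul_eq hτ hA hrT hsT hv⟩

theorem card_decides_mul_le {τ : ℕ} (hτ : 0 < τ) (hA : ∀ i, A (i + τ) = A i)
    (hB : ∀ i, B i ∈ S) (hd : d ∉ S) (K : ℕ) :
    Nat.card {f : CARule n // Decides f A B} * (n * K) ≤
      (K * τ * K + n) * S.card * Nat.card {f : CARule n // RightExtends f A B} := by
  classical
  rw [Nat.card_eq_fintype_card, Nat.card_eq_fintype_card, Fintype.card_subtype,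
    Fintype.card_subtype]
  set R := (Finset.univ.filter fun f : CARule n => RightExtends f A B).card
  let early : ℕ → Finset (CARule n) := fun T =>
    Finset.univ.filter fun f => RightExtends f A B ∧ IsFirstHit f A d S (T + 1)
  let late : Finset (CARule n) := Finset.univ.filter fun f =>
    RightExtends f A B ∧ ∃ T, K * τ ≤ T + 1 ∧ IsFirstHit f A d S (T + 1)
  have hsub : (Finset.univ.filter fun f : CARule n => Decides f A B) ⊆
      (Finset.range (K * τ)).biUnion early ∪ late := by
    intro f hf
    obtain ⟨hRE, hdec⟩ := (Finset.mem_filter.1 hf).2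
    obtain ⟨j, hj⟩ := hdec d
    obtain ⟨T, hT⟩ := exists_isFirstHit (S := S) (hj ▸ hB j)
    obtain _ | T := T
    · exact absurd hT.1 hd
    rcases lt_or_ge T (K * τ) with hlt | hge
    · refine Finset.mem_union_left _ (Finset.mem_biUnion.2 ⟨T, Finset.mem_range.2 hlt, ?_⟩)
      exact Finset.mem_filter.2 ⟨Finset.mem_univ _, hRE, hT⟩
    · refine Finset.mem_union_right _ (Finset.mem_filter.2 ⟨Finset.mem_univ _, hRE, T, ?_, hT⟩)
      omega
  have hcard : (Finset.univ.filter fun f : CARule n => Decides f A B).card ≤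
      ∑ T ∈ Finset.range (K * τ), (early T).card + late.card :=
    (Finset.card_le_card hsub).trans
      ((Finset.card_union_le _ _).trans (Nat.add_le_add_right Finset.card_biUnion_le _))
  have hearly : (∑ T ∈ Finset.range (K * τ), (early T).card) * n ≤ K * τ * (S.card * R) := by
    rw [Finset.sum_mul]
    refine (Finset.sum_le_card_nsmul _ _ _ fun T _ => card_isFirstHit_mul_le hB T).trans ?_
    simp [R]
  have hlate : late.card * K ≤ S.card * R := card_late_isFirstHit_mul_le hτ hA hB K
  calc _ ≤ (∑ T ∈ Finset.range (K * τ), (early T).card + late.card) * (n * K) :=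
        Nat.mul_le_mul_right _ hcard
    _ = (∑ T ∈ Finset.range (K * τ), (early T).card) * n * K + late.card * K * n := by ring
    _ ≤ K * τ * (S.card * R) * K + S.card * R * n := by gcongr
    _ = _ := by ring

end FirstHit

/-- for fixed consistent labels `A, B` of length `τ` (entries in
`{0,…,τ−1}`), viewed as labels over `ℤ_n` for each `n ≥ τ` (here `n = m + τ`),
the conditional probability `P(A ⇒ B | A → B)` tends to `0` as `n → ∞`. -/
theorem general_label_deciding_probability (τ : ℕ) (hτ : 1 ≤ τ) (A B : ℕ → ℕ)
    (hA : ∀ i, A i < τ) (hB : ∀ i, B i < τ)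
    (hAper : ∀ i, A (i + τ) = A i) (hBper : ∀ i, B (i + τ) = B i)
    (hcons : ∀ i k, A i = A k → B i = B k → B (i + 1) = B (k + 1)) :
    Filter.Tendsto
      (fun m : ℕ =>
        (Nat.card {f : CARule (m + τ) //
            Decides f
              (fun i => (⟨A i, lt_of_lt_of_le (hA i) (Nat.le_add_left τ m)⟩ : Fin (m + τ)))
              (fun i => (⟨B i, lt_of_lt_of_le (hB i) (Nat.le_add_left τ m)⟩ : Fin (m + τ)))} : ℝ) /
        (Nat.card {f : CARule (m + τ) //
            RightExtends f
              (fun i => (⟨A i, lt_of_lt_of_le (hA i) (Nat.le_add_left τ m)⟩ : Fin (m + τ)))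
              (fun i => (⟨B i, lt_of_lt_of_le (hB i) (Nat.le_add_left τ m)⟩ : Fin (m + τ)))} : ℝ))
      Filter.atTop (nhds 0) := by
  refine squeeze_zero' (g := fun m : ℕ => ((τ * τ + τ : ℕ) : ℝ) / (Nat.sqrt (m + τ) : ℝ))
    (Eventually.of_forall fun m => by positivity) ?_ ?_
  · filter_upwards [eventually_ge_atTop 1] with m hm
    set K := Nat.sqrt (m + τ) with hK
    have hKpos : 0 < K := Nat.sqrt_pos.2 (by omega)
    have hKle : K * K ≤ m + τ := Nat.sqrt_le _
    let S : Finset (Fin (m + τ)) := Finset.univ.filter fun x => x.val < τ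
    have hS : S.card ≤ τ := by
      refine (Finset.card_le_card_of_injOn (t := Finset.range τ) Fin.val ?_
        Fin.val_injective.injOn).trans (Finset.card_range τ).le
      intro x hx
      simpa [S] using hx
    have key := card_decides_mul_le (n := m + τ) (S := S)
      (A := fun i => ⟨A i, lt_of_lt_of_le (hA i) (Nat.le_add_left τ m)⟩)
      (B := fun i => ⟨B i, lt_of_lt_of_le (hB i) (Nat.le_add_left τ m)⟩)
      (d := ⟨τ, by omega⟩) hτ (fun i => Fin.ext (hAper i)) (fun i => by simp [S, hB i])
      (by simp [S]) K
    generalize Nat.card {f : CARule (m + τ) // Decides f _ _} = D at key ⊢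
    generalize Nat.card {f : CARule (m + τ) // RightExtends f _ _} = R at key ⊢
    have hDR : D * K ≤ (τ * τ + τ) * R := by
      refine le_of_mul_le_mul_left (a := m + τ) ?_ (by omega)
      calc (m + τ) * (D * K) = D * ((m + τ) * K) := by ring
        _ ≤ (K * τ * K + (m + τ)) * S.card * R := key
        _ = (K * K * τ + (m + τ)) * S.card * R := by ring
        _ ≤ ((m + τ) * τ + (m + τ)) * τ * R := by gcongr
        _ = (m + τ) * ((τ * τ + τ) * R) := by ring
    rcases Nat.eq_zero_or_pos R with rfl | hR
    · simp only [Nat.cast_zero, div_zero]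
      positivity
    · rw [div_le_div_iff₀ (by exact_mod_cast hR) (by exact_mod_cast hKpos)]
      exact_mod_cast hDR
  · refine tendsto_const_nhds.div_atTop (tendsto_natCast_atTop_atTop.comp ?_)
    refine tendsto_atTop.2 fun b => ?_
    filter_upwards [eventually_ge_atTop (b * b)] with m hm
    exact Nat.le_sqrt.2 (by omega)
end
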